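/- Assume β > 157/17. For every T > 0, M ≥ 1 and ε ∈ (0,1] there exists a constant C > 0, depending only on M, ε and T, such that every smooth solution (v,u,θ,q) of the radiation hydrodynamics system on [0,T] with (M,ε)-bounded initial data satisfies ‖q_{xx}(t,·)‖² ≤ C for all t ∈ [0,T]. -/

import Mathlib

open MeasureTheory Real Set

noncomputable section

namespace RadHydro

/-- Integral over one period `[-1/2, 1/2]` of the torus `𝕋 ≅ ℝ/ℤ`. -/
def tInt (f : ℝ → ℝ) : ℝ := ∫ x in (-(1/2) : ℝ)..(1/2 : ℝ), f x

/-- Squared `L²` norm over the torus. -/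
def L2sq (f : ℝ → ℝ) : ℝ := tInt fun x => (f x) ^ 2

/-- `L^∞` norm over the torus. -/
def Linf (f : ℝ → ℝ) : ℝ := sSup ((fun x => |f x|) '' Icc (-(1/2) : ℝ) (1/2))

/-- Squared `H¹` norm over the torus. -/
def H1sq (f : ℝ → ℝ) : ℝ := L2sq f + L2sq (deriv f)

/-- Squared `H²` norm over the torus. -/
def H2sq (f : ℝ → ℝ) : ℝ := L2sq f + L2sq (deriv f) + L2sq (deriv (deriv f))

/-- Partial derivative in the time variable. -/
def pt (f : ℝ → ℝ → ℝ) (t x : ℝ) : ℝ := deriv (fun s => f s x) t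

/-- Partial derivative in the space variable. -/
def px (f : ℝ → ℝ → ℝ) (t x : ℝ) : ℝ := deriv (f t) x

/-- The heat conductivity `κ(v, θ) = κ₁ + κ₂ v θ^β`. -/
def kappa (κ₁ κ₂ β v θ : ℝ) : ℝ := κ₁ + κ₂ * v * θ ^ β

/-- A smooth solution of the radiation hydrodynamics system (in Lagrangian
coordinates) on `[0, T]`: four `C^∞` functions on `[0,T] × ℝ` (modelled as smooth
functions on all of `ℝ × ℝ`), `1`-periodic in the space variable, with `v > 0`,
`θ > 0`, satisfying the four equations pointwise for `t ∈ [0, T]`, and with the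
normalization `∫_𝕋 v(0, x) dx = 1`. -/
structure Sol (μ R a b κ₁ κ₂ β γ T : ℝ) where
  v : ℝ → ℝ → ℝ
  u : ℝ → ℝ → ℝ
  θ : ℝ → ℝ → ℝ
  q : ℝ → ℝ → ℝ
  smooth_v : ContDiff ℝ (⊤ : ℕ∞) fun p : ℝ × ℝ => v p.1 p.2
  smooth_u : ContDiff ℝ (⊤ : ℕ∞) fun p : ℝ × ℝ => u p.1 p.2
  smooth_θ : ContDiff ℝ (⊤ : ℕ∞) fun p : ℝ × ℝ => θ p.1 p.2
  smooth_q : ContDiff ℝ (⊤ : ℕ∞) fun p : ℝ × ℝ => q p.1 p.2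
  periodic_v : ∀ t, Function.Periodic (v t) 1
  periodic_u : ∀ t, Function.Periodic (u t) 1
  periodic_θ : ∀ t, Function.Periodic (θ t) 1
  periodic_q : ∀ t, Function.Periodic (q t) 1
  v_pos : ∀ t x, 0 < v t x
  θ_pos : ∀ t x, 0 < θ t x
  eq_mass : ∀ t ∈ Icc (0 : ℝ) T, ∀ x : ℝ, pt v t x - px u t x = 0
  eq_mom : ∀ t ∈ Icc (0 : ℝ) T, ∀ x : ℝ,
    pt u t x + px (fun s y => R * θ s y / v s y) t x
      = px (fun s y => μ * px u s y / v s y) t x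
  eq_energy : ∀ t ∈ Icc (0 : ℝ) T, ∀ x : ℝ,
    pt (fun s y => R / (γ - 1) * θ s y + (u s y) ^ 2 / 2) t x
      + px (fun s y => R * θ s y / v s y * u s y) t x + px q t x
      = px (fun s y => μ * u s y * px u s y / v s y) t x
        + px (fun s y => kappa κ₁ κ₂ β (v s y) (θ s y) * px θ s y / v s y) t x
  eq_rad : ∀ t ∈ Icc (0 : ℝ) T, ∀ x : ℝ,
    -px (fun s y => px q s y / v s y) t x + a * v t x * q t x
      + b * px (fun s y => (θ s y) ^ 4) t x = 0
  mean_v : tInt (v 0) = 1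

/-- `(M, ε)`-bounded initial data: `‖(v₀, u₀, θ₀)‖_{H²} ≤ M` and `v₀ ≥ ε`, `θ₀ ≥ ε`. -/
def DataBounded (M ε : ℝ) (v₀ u₀ θ₀ : ℝ → ℝ) : Prop :=
  Real.sqrt (H2sq v₀ + H2sq u₀ + H2sq θ₀) ≤ M ∧ (∀ x, ε ≤ v₀ x) ∧ ∀ x, ε ≤ θ₀ x

variable {μ R a b κ₁ κ₂ β γ T : ℝ}

/-- A solution has `(M, ε)`-bounded initial data. -/
def Sol.Bounded (S : Sol μ R a b κ₁ κ₂ β γ T) (M ε : ℝ) : Prop :=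
  DataBounded M ε (S.v 0) (S.u 0) (S.θ 0)

/-- The auxiliary function `𝔛(t) = ∫₀ᵗ ∫_𝕋 κ(v,θ) θ_t² / v dx ds`. -/
def Sol.X (S : Sol μ R a b κ₁ κ₂ β γ T) (t : ℝ) : ℝ :=
  ∫ s in (0 : ℝ)..t, tInt fun x =>
    kappa κ₁ κ₂ β (S.v s x) (S.θ s x) * (pt S.θ s x) ^ 2 / S.v s x

/-- The auxiliary function `𝔜(t) = max_{0 ≤ s ≤ t} ∫_𝕋 κ(v,θ)² θ_x² / v² dx`. -/
def Sol.Y (S : Sol μ R a b κ₁ κ₂ β γ T) (t : ℝ) : ℝ :=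
  sSup ((fun s => tInt fun x =>
    (kappa κ₁ κ₂ β (S.v s x) (S.θ s x)) ^ 2 * (px S.θ s x) ^ 2 / (S.v s x) ^ 2) ''
      Icc (0 : ℝ) t)

/-- The auxiliary function `ℨ(t) = max_{0 ≤ s ≤ t} ∫_𝕋 u_{xx}² / v² dx`. -/
def Sol.Z (S : Sol μ R a b κ₁ κ₂ β γ T) (t : ℝ) : ℝ :=
  sSup ((fun s => tInt fun x => (px (px S.u) s x) ^ 2 / (S.v s x) ^ 2) '' Icc (0 : ℝ) t)

/-- The exponent `𝔗₀(n, p, β)`. -/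
def T0 (n _p β : ℝ) : ℝ :=
  if n < (β + 3) / 2 then 4 / (n * (2 * β + 3)) else (n - β + 5) / (n * (2 * β + 3))

/-- The exponent `𝔗₁(n, β)`. -/
def T1 (n β : ℝ) : ℝ := max (T0 n 8 β) (1 / (2 * β + 3) + T0 n 1 β)

/-- The exponent `𝔘ʸ₁₁(n, β)`. -/
def Uy11 (n β : ℝ) : ℝ := 2 / (2 * β + 3) + T0 n 1 β

/-- The exponent `𝔘ᶻ₁₁(n, β)`. -/
def Uz11 (n β : ℝ) : ℝ := 3 / 4 * (1 / (1 - T0 n (5/2) β))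

/-- The exponent `𝔘ʸ₂(n, β)`. -/
def Uy2 (n β : ℝ) : ℝ := 2 / (2 * β + 3) + T1 n β

/-- The exponent `𝔘ᶻ₂(n, β)`. -/
def Uz2 (n β : ℝ) : ℝ := 3 / 4 * (1 / (1 - T0 n (3/2) β - T1 n β))

end RadHydro

open RadHydro

namespace RadHydro

open Filter Topology intervalIntegral

/-- A smooth function of time and space that is `1`-periodic in space. -/
structure SmoothPeriodic (f : ℝ → ℝ → ℝ) : Prop where
  smooth : ContDiff ℝ (⊤ : ℕ∞) fun p : ℝ × ℝ => f p.1 p.2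
  periodic : ∀ t, Function.Periodic (f t) 1

namespace SmoothPeriodic

variable {f g : ℝ → ℝ → ℝ}

theorem hasFDerivAt (h : SmoothPeriodic f) (p : ℝ × ℝ) :
    HasFDerivAt (fun p : ℝ × ℝ => f p.1 p.2) (fderiv ℝ (fun p : ℝ × ℝ => f p.1 p.2) p) p :=
  ((h.smooth.differentiable (by simp)) p).hasFDerivAt

theorem hasDerivAt_fderiv_px (h : SmoothPeriodic f) (t x : ℝ) :
    HasDerivAt (f t) (fderiv ℝ (fun p : ℝ × ℝ => f p.1 p.2) (t, x) (0, 1)) x :=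
  (h.hasFDerivAt (t, x)).comp_hasDerivAt x ((hasDerivAt_const x t).prodMk (hasDerivAt_id x))

theorem hasDerivAt_fderiv_pt (h : SmoothPeriodic f) (t x : ℝ) :
    HasDerivAt (fun s => f s x) (fderiv ℝ (fun p : ℝ × ℝ => f p.1 p.2) (t, x) (1, 0)) t :=
  HasFDerivAt.comp_hasDerivAt (f := fun s : ℝ => (s, x)) t (h.hasFDerivAt (t, x))
    ((hasDerivAt_id t).prodMk (hasDerivAt_const t x))

theorem hasDerivAt_px (h : SmoothPeriodic f) (t x : ℝ) : HasDerivAt (f t) (px f t x) x :=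
  (h.hasDerivAt_fderiv_px t x).differentiableAt.hasDerivAt

theorem hasDerivAt_pt (h : SmoothPeriodic f) (t x : ℝ) :
    HasDerivAt (fun s => f s x) (pt f t x) t :=
  (h.hasDerivAt_fderiv_pt t x).differentiableAt.hasDerivAt

theorem joint (h : SmoothPeriodic f) : Continuous fun p : ℝ × ℝ => f p.1 p.2 :=
  h.smooth.continuous

theorem cont (h : SmoothPeriodic f) (t : ℝ) : Continuous (f t) :=
  h.joint.comp (Continuous.prodMk continuous_const continuous_id)

theorem px (h : SmoothPeriodic f) : SmoothPeriodic (px f) where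
  smooth := by
    have e : (fun p : ℝ × ℝ => RadHydro.px f p.1 p.2) =
        fun p => fderiv ℝ (fun p : ℝ × ℝ => f p.1 p.2) p (0, 1) := by
      ext p; exact (h.hasDerivAt_fderiv_px p.1 p.2).deriv
    rw [e]
    exact (h.smooth.fderiv_right (m := (⊤ : ℕ∞)) (by simp)).clm_apply contDiff_const
  periodic t x := by
    have e : (fun y => f t (y + 1)) = f t := funext (h.periodic t)
    have := deriv_comp_add_const (f t) 1 x
    rw [e] at this
    exact this.symm

theorem pt (h : SmoothPeriodic f) : SmoothPeriodic (pt f) where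
  smooth := by
    have e : (fun p : ℝ × ℝ => RadHydro.pt f p.1 p.2) =
        fun p => fderiv ℝ (fun p : ℝ × ℝ => f p.1 p.2) p (1, 0) := by
      ext p; exact (h.hasDerivAt_fderiv_pt p.1 p.2).deriv
    rw [e]
    exact (h.smooth.fderiv_right (m := (⊤ : ℕ∞)) (by simp)).clm_apply contDiff_const
  periodic t x := by
    simp only [RadHydro.pt, h.periodic _ x]

theorem comm (h : SmoothPeriodic f) (t x : ℝ) :
    RadHydro.pt (RadHydro.px f) t x = RadHydro.px (RadHydro.pt f) t x := by
  have e1 : (fun s => RadHydro.px f s x) =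
      fun s => fderiv ℝ (fun p : ℝ × ℝ => f p.1 p.2) (s, x) (0, 1) := by
    ext s; exact (h.hasDerivAt_fderiv_px s x).deriv
  have e2 : (RadHydro.pt f t) =
      fun y => fderiv ℝ (fun p : ℝ × ℝ => f p.1 p.2) (t, y) (1, 0) := by
    ext y; exact (h.hasDerivAt_fderiv_pt t y).deriv
  have hd : DifferentiableAt ℝ (fderiv ℝ (fun p : ℝ × ℝ => f p.1 p.2)) (t, x) :=
    (h.smooth.fderiv_right (m := (⊤ : ℕ∞)) (by simp)).differentiable (by simp) _
  have d1 : HasDerivAt (fun s => fderiv ℝ (fun p : ℝ × ℝ => f p.1 p.2) (s, x))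
      (fderiv ℝ (fderiv ℝ (fun p : ℝ × ℝ => f p.1 p.2)) (t, x) (1, 0)) t :=
    hd.hasFDerivAt.comp_hasDerivAt t ((hasDerivAt_id t).prodMk (hasDerivAt_const t x))
  have d2 : HasDerivAt (fun y => fderiv ℝ (fun p : ℝ × ℝ => f p.1 p.2) (t, y))
      (fderiv ℝ (fderiv ℝ (fun p : ℝ × ℝ => f p.1 p.2)) (t, x) (0, 1)) x :=
    hd.hasFDerivAt.comp_hasDerivAt x ((hasDerivAt_const x t).prodMk (hasDerivAt_id x))
  have d1' := (d1.clm_apply (hasDerivAt_const t ((0, 1) : ℝ × ℝ))).deriv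
  have d2' := (d2.clm_apply (hasDerivAt_const x ((1, 0) : ℝ × ℝ))).deriv
  have sy : IsSymmSndFDerivAt ℝ (fun p : ℝ × ℝ => f p.1 p.2) (t, x) :=
    h.smooth.contDiffAt.isSymmSndFDerivAt (by
      simp only [minSmoothness_of_isRCLikeNormedField]
      exact WithTop.coe_le_coe.2 (le_top : (2 : ℕ∞) ≤ ⊤))
  have l : RadHydro.pt (RadHydro.px f) t x = deriv (fun s => RadHydro.px f s x) t := rfl
  have r : RadHydro.px (RadHydro.pt f) t x = deriv (RadHydro.pt f t) x := rfl
  rw [l, r, e1, e2, d1', d2']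
  simpa using sy.eq (1, 0) (0, 1)

theorem add (h : SmoothPeriodic f) (k : SmoothPeriodic g) :
    SmoothPeriodic fun t x => f t x + g t x :=
  ⟨h.smooth.add k.smooth, fun t x => by simp only [h.periodic t x, k.periodic t x]⟩

theorem sub (h : SmoothPeriodic f) (k : SmoothPeriodic g) :
    SmoothPeriodic fun t x => f t x - g t x :=
  ⟨h.smooth.sub k.smooth, fun t x => by simp only [h.periodic t x, k.periodic t x]⟩

theorem mul (h : SmoothPeriodic f) (k : SmoothPeriodic g) :
    SmoothPeriodic fun t x => f t x * g t x :=
  ⟨h.smooth.mul k.smooth, fun t x => by simp only [h.periodic t x, k.periodic t x]⟩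

theorem const (c : ℝ) : SmoothPeriodic fun _ _ => c :=
  ⟨contDiff_const, fun _ _ => rfl⟩

theorem pow (h : SmoothPeriodic f) (n : ℕ) : SmoothPeriodic fun t x => f t x ^ n :=
  ⟨h.smooth.pow n, fun t x => by simp only [h.periodic t x]⟩

theorem div (h : SmoothPeriodic f) (k : SmoothPeriodic g) (hg : ∀ t x, 0 < g t x) :
    SmoothPeriodic fun t x => f t x / g t x :=
  ⟨h.smooth.div k.smooth fun p => (hg p.1 p.2).ne',
    fun t x => by simp only [h.periodic t x, k.periodic t x]⟩

theorem log (h : SmoothPeriodic f) (hf : ∀ t x, 0 < f t x) :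
    SmoothPeriodic fun t x => Real.log (f t x) :=
  ⟨h.smooth.log fun p => (hf p.1 p.2).ne', fun t x => by simp only [h.periodic t x]⟩

theorem rpow (h : SmoothPeriodic f) (hf : ∀ t x, 0 < f t x) (r : ℝ) :
    SmoothPeriodic fun t x => f t x ^ r :=
  ⟨h.smooth.rpow_const_of_ne fun p => (hf p.1 p.2).ne',
    fun t x => by simp only [h.periodic t x]⟩

end SmoothPeriodic

section TorusIntegral

variable {f g h k : ℝ → ℝ}

theorem tInt_mono (hf : Continuous f) (hg : Continuous g) (hfg : ∀ x, f x ≤ g x) :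
    tInt f ≤ tInt g :=
  integral_mono (by norm_num) (hf.intervalIntegrable _ _) (hg.intervalIntegrable _ _) hfg

theorem tInt_add (hf : Continuous f) (hg : Continuous g) :
    tInt (fun x => f x + g x) = tInt f + tInt g :=
  integral_add (hf.intervalIntegrable _ _) (hg.intervalIntegrable _ _)

theorem tInt_const (c : ℝ) : tInt (fun _ => c) = c := by
  norm_num [tInt]

theorem tInt_const_mul (c : ℝ) (f : ℝ → ℝ) : tInt (fun x => c * f x) = c * tInt f :=
  integral_const_mul c f

theorem tInt_nonneg (hf : ∀ x, 0 ≤ f x) : 0 ≤ tInt f :=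
  integral_nonneg (by norm_num) fun x _ => hf x

theorem tInt_combination (hg : Continuous g) (hh : Continuous h) (hk : Continuous k)
    (c₁ c₂ c₃ c₄ : ℝ) :
    tInt (fun x => c₁ * g x + c₂ * h x + c₃ * k x + c₄) =
      c₁ * tInt g + c₂ * tInt h + c₃ * tInt k + c₄ := by
  rw [tInt_add (f := fun x => c₁ * g x + c₂ * h x + c₃ * k x) (by fun_prop) continuous_const,
    tInt_add (f := fun x => c₁ * g x + c₂ * h x) (by fun_prop) (by fun_prop),
    tInt_add (by fun_prop) (by fun_prop),
    tInt_const_mul, tInt_const_mul, tInt_const_mul, tInt_const]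

theorem tInt_le_combination (hf : Continuous f) (hg : Continuous g) (hh : Continuous h)
    (hk : Continuous k) {c₁ c₂ c₃ c₄ : ℝ}
    (H : ∀ x, f x ≤ c₁ * g x + c₂ * h x + c₃ * k x + c₄) :
    tInt f ≤ c₁ * tInt g + c₂ * tInt h + c₃ * tInt k + c₄ := by
  rw [← tInt_combination hg hh hk]
  exact tInt_mono hf (by fun_prop) H

theorem tInt_deriv_eq_zero {f' : ℝ → ℝ} (hf : ∀ x, HasDerivAt f (f' x) x)
    (hf' : Continuous f') (hp : Function.Periodic f 1) : tInt f' = 0 := by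
  rw [tInt, integral_eq_sub_of_hasDerivAt (fun x _ => hf x) (hf'.intervalIntegrable _ _)]
  have := hp (-(1 / 2))
  norm_num at this ⊢
  rw [this, sub_self]

/-- Values at two points of one period differ by at most the integral of a majorant of `|f'|`. -/
theorem sub_le_tInt {f' : ℝ → ℝ} (hf : ∀ x, HasDerivAt f (f' x) x)
    (hf' : Continuous f') (hg : Continuous g) (hfg : ∀ x, |f' x| ≤ g x)
    {x y : ℝ} (hx : x ∈ Icc (-(1 / 2) : ℝ) (1 / 2)) (hy : y ∈ Icc (-(1 / 2) : ℝ) (1 / 2)) :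
    f x - f y ≤ tInt g := by
  rw [← integral_eq_sub_of_hasDerivAt (fun x _ => hf x) (hf'.intervalIntegrable _ _)]
  refine (le_abs_self _).trans ((Real.norm_eq_abs _).symm.le.trans
    (norm_integral_le_integral_norm_uIoc.trans ?_))
  simp only [Real.norm_eq_abs]
  rw [tInt, integral_of_le (by norm_num)]
  refine (setIntegral_mono_set (hf'.abs.integrableOn_Ioc) ?_ ?_).trans
    (setIntegral_mono (hf'.abs.integrableOn_Ioc) (hg.integrableOn_Ioc) hfg)
  · exact Filter.Eventually.of_forall fun x => abs_nonneg _
  · refine LE.le.eventuallyLE (Ioc_subset_Ioc ?_ ?_)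
    · exact le_min hy.1 hx.1
    · exact max_le hy.2 hx.2

/-- The value of `f` at some point of the period is at most its mean. -/
theorem exists_le_tInt (hf : Continuous f) :
    ∃ y ∈ Icc (-(1 / 2) : ℝ) (1 / 2), f y ≤ tInt f := by
  obtain ⟨y, hy, hm⟩ := isCompact_Icc.exists_isMinOn
    (nonempty_Icc.2 (by norm_num : (-(1 / 2) : ℝ) ≤ 1 / 2)) hf.continuousOn
  refine ⟨y, hy, ?_⟩
  rw [← tInt_const (f y)]
  exact integral_mono_on (by norm_num) (by simp) (hf.intervalIntegrable _ _)
    fun x hx => hm hx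

theorem exists_mem_period (x : ℝ) (hf : Function.Periodic f 1) :
    ∃ y ∈ Icc (-(1 / 2) : ℝ) (1 / 2), f x = f y := by
  obtain ⟨y, hy, h⟩ := hf.exists_mem_Ico one_pos x (-(1 / 2))
  exact ⟨y, ⟨hy.1, by linarith [hy.2]⟩, h⟩

/-- Pointwise bound by the mean and the integral of a majorant of the derivative. -/
theorem le_tInt_add_tInt {f' : ℝ → ℝ} (hf : ∀ x, HasDerivAt f (f' x) x)
    (hf' : Continuous f') (hp : Function.Periodic f 1) (hg : Continuous g)
    (hfg : ∀ x, |f' x| ≤ g x) (x : ℝ) : f x ≤ tInt f + tInt g := by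
  obtain ⟨z, hz, e⟩ := exists_mem_period x hp
  have hc : Continuous f := continuous_iff_continuousAt.2 fun x => (hf x).continuousAt
  obtain ⟨y, hy, hle⟩ := exists_le_tInt hc
  have := sub_le_tInt hf hf' hg hfg hz hy
  linarith

/-- One-dimensional Sobolev inequality with a small constant in front of the derivative. -/
theorem sq_le_of_deriv {f' : ℝ → ℝ} (hf : ∀ x, HasDerivAt f (f' x) x)
    (hf' : Continuous f') (hp : Function.Periodic f 1) {δ : ℝ} (hδ : 0 < δ) (x : ℝ) :
    f x ^ 2 ≤ (1 + 1 / δ) * tInt (fun y => f y ^ 2) + δ * tInt (fun y => f' y ^ 2) := by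
  have hc : Continuous f := continuous_iff_continuousAt.2 fun x => (hf x).continuousAt
  have key := le_tInt_add_tInt (f := fun y => f y ^ 2) (f' := fun y => 2 * f y * f' y)
    (g := fun y => 1 / δ * f y ^ 2 + δ * f' y ^ 2 + 0 * f y + 0)
    (fun y => by simpa using (hf y).fun_pow 2) (by fun_prop)
    (fun y => by simp only [hp y]) (by fun_prop) (fun y => by
      have e : 1 / δ * f y ^ 2 = δ * (f y / δ) ^ 2 := by field_simp
      have e2 : f y = δ * (f y / δ) := by field_simp
      rw [e]
      set w := f y / δ
      rw [abs_le]
      constructor <;> rw [e2] <;>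
        nlinarith [mul_nonneg hδ.le (sq_nonneg (w + f' y)),
          mul_nonneg hδ.le (sq_nonneg (w - f' y))]) x
  rw [tInt_combination (g := fun y => f y ^ 2) (h := fun y => f' y ^ 2) (by fun_prop)
    (by fun_prop) hc] at key
  linarith

/-- Differentiation under the integral sign. -/
theorem hasDerivAt_integral_param {f f' : ℝ → ℝ → ℝ} (hf : ∀ t, Continuous (f t))
    (hf' : Continuous fun p : ℝ × ℝ => f' p.1 p.2)
    (hd : ∀ t x, HasDerivAt (fun s => f s x) (f' t x) t) (l r t : ℝ) :
    HasDerivAt (fun s => ∫ x in l..r, f s x) (∫ x in l..r, f' t x) t := by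
  obtain ⟨K, hK⟩ := (isCompact_Icc.prod isCompact_uIcc :
    IsCompact (Icc (t - 1) (t + 1) ×ˢ uIcc l r)).exists_bound_of_continuousOn hf'.continuousOn
  refine (hasDerivAt_integral_of_dominated_loc_of_deriv_le (s := Icc (t - 1) (t + 1))
    (bound := fun _ => K) (Icc_mem_nhds (by linarith) (by linarith))
    (Eventually.of_forall fun s => (hf s).aestronglyMeasurable)
    ((hf t).intervalIntegrable _ _) ?_ ?_ (by simp) ?_).2
  · exact (hf'.comp (Continuous.prodMk continuous_const continuous_id)).aestronglyMeasurable
  · refine Eventually.of_forall fun x hx s hs => ?_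
    exact hK (s, x) ⟨hs, uIoc_subset_uIcc hx⟩
  · exact Eventually.of_forall fun x _ s _ => hd s x

theorem continuous_tInt {f : ℝ → ℝ → ℝ} (hf : Continuous fun p : ℝ × ℝ => f p.1 p.2) :
    Continuous fun t => tInt (f t) :=
  continuous_parametric_intervalIntegral_of_continuous' (f := f) hf _ _

end TorusIntegral

namespace SmoothPeriodic

variable {f g : ℝ → ℝ → ℝ}

theorem hasDerivAt_tInt (h : SmoothPeriodic f) (t : ℝ) :
    HasDerivAt (fun s => tInt (f s)) (tInt (RadHydro.pt f t)) t :=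
  hasDerivAt_integral_param h.cont h.pt.joint (fun t x => h.hasDerivAt_pt t x) _ _ t

theorem continuous_tInt (h : SmoothPeriodic f) : Continuous fun t => tInt (f t) :=
  RadHydro.continuous_tInt h.joint

theorem tInt_px (h : SmoothPeriodic f) (t : ℝ) : tInt (RadHydro.px f t) = 0 :=
  tInt_deriv_eq_zero (h.hasDerivAt_px t) (h.px.cont t) (h.periodic t)

theorem sq_le (h : SmoothPeriodic f) {δ : ℝ} (hδ : 0 < δ) (t x : ℝ) :
    f t x ^ 2 ≤ (1 + 1 / δ) * tInt (fun y => f t y ^ 2)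
      + δ * tInt (fun y => RadHydro.px f t y ^ 2) :=
  sq_le_of_deriv (h.hasDerivAt_px t) (h.px.cont t) (h.periodic t) hδ x

end SmoothPeriodic

section Gronwall

variable {T : ℝ}

theorem monotone_of_deriv_le {f f' : ℝ → ℝ} (hf : ∀ t ∈ Icc 0 T, HasDerivAt f (f' t) t)
    (hf' : ∀ t ∈ Icc 0 T, f' t ≤ 0) {t : ℝ} (ht : t ∈ Icc 0 T) : f t ≤ f 0 := by
  have hT : (0 : ℝ) ≤ T := ht.1.trans ht.2
  refine antitoneOn_of_deriv_nonpos (convex_Icc 0 T)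
    (fun s hs => (hf s hs).continuousAt.continuousWithinAt)
    (fun s hs => (hf s (interior_subset hs)).differentiableAt.differentiableWithinAt)
    (fun s hs => ?_) ⟨le_rfl, hT⟩ ht ht.1
  rw [(hf s (interior_subset hs)).deriv]
  exact hf' s (interior_subset hs)

theorem hasDerivAt_primitive {f : ℝ → ℝ} (hf : Continuous f) (t : ℝ) :
    HasDerivAt (fun t => ∫ s in (0 : ℝ)..t, f s) (f t) t :=
  integral_hasDerivAt_right (hf.intervalIntegrable _ _)
    (hf.stronglyMeasurableAtFilter _ _) hf.continuousAt

theorem primitive_le {f : ℝ → ℝ} (hf : Continuous f) (h0 : ∀ t, 0 ≤ f t) {t : ℝ}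
    (ht : t ∈ Icc 0 T) : (∫ s in (0 : ℝ)..t, f s) ≤ ∫ s in (0 : ℝ)..T, f s :=
  integral_mono_interval le_rfl ht.1 ht.2 (Eventually.of_forall h0) (hf.intervalIntegrable _ _)

/-- Gronwall's inequality with a dissipation term. -/
theorem gronwall_dissipation (hT : 0 ≤ T) {E E' D A B : ℝ → ℝ} {E₀ KA KB : ℝ}
    (hE : ∀ t ∈ Icc 0 T, HasDerivAt E (E' t) t)
    (hD : Continuous D) (hA : Continuous A) (hB : Continuous B)
    (E_nonneg : ∀ t, 0 ≤ E t) (D_nonneg : ∀ t, 0 ≤ D t) (A_nonneg : ∀ t, 0 ≤ A t)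
    (B_nonneg : ∀ t, 0 ≤ B t)
    (H : ∀ t ∈ Icc 0 T, E' t + D t ≤ A t * E t + B t)
    (h0 : E 0 ≤ E₀) (hKA : (∫ s in (0 : ℝ)..T, A s) ≤ KA) (hKB : (∫ s in (0 : ℝ)..T, B s) ≤ KB) :
    (∀ t ∈ Icc 0 T, E t ≤ (E₀ + KB) * exp KA) ∧
      (∫ s in (0 : ℝ)..T, D s) ≤ (E₀ + KB) * exp KA := by
  set α : ℝ → ℝ := fun t => ∫ s in (0 : ℝ)..t, A s with hα
  have dα : ∀ t, HasDerivAt α (A t) t := hasDerivAt_primitive hA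
  have cα : Continuous α := continuous_iff_continuousAt.2 fun t => (dα t).continuousAt
  have α_nonneg : ∀ t, 0 ≤ t → 0 ≤ α t := fun t ht => integral_nonneg ht fun s _ => A_nonneg s
  have cD : Continuous fun s => exp (-α s) * D s := by fun_prop
  have key : ∀ t ∈ Icc 0 T, exp (-α t) * E t + (∫ s in (0 : ℝ)..t, exp (-α s) * D s)
      - (∫ s in (0 : ℝ)..t, B s) ≤ E 0 := by
    intro t ht
    have := monotone_of_deriv_le (T := T)
      (f := fun t => exp (-α t) * E t + (∫ s in (0 : ℝ)..t, exp (-α s) * D s)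
        - (∫ s in (0 : ℝ)..t, B s))
      (fun t ht => (((dα t).neg.exp.mul (hE t ht)).add (hasDerivAt_primitive cD t)).sub
        (hasDerivAt_primitive hB t)) (fun t ht => by
          have h1 := H t ht
          have h2 : exp (-α t) ≤ 1 := exp_le_one_iff.2 (by linarith [α_nonneg t ht.1])
          have h3 := mul_le_mul_of_nonneg_left h1 (exp_pos (-α t)).le
          have h4 := mul_le_mul_of_nonneg_right h2 (B_nonneg t)
          simp only [Pi.neg_apply]
          nlinarith) ht
    simpa [hα] using this
  have up : ∀ t ∈ Icc 0 T, exp (-KA) ≤ exp (-α t) := fun t ht =>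
    exp_le_exp.2 (neg_le_neg ((primitive_le hA A_nonneg ht).trans hKA))
  have fin : ∀ y, exp (-KA) * y ≤ E₀ + KB → y ≤ (E₀ + KB) * exp KA := by
    intro y hy
    have := mul_le_mul_of_nonneg_right hy (exp_pos KA).le
    have e : exp (-KA) * exp KA = 1 := by rw [← Real.exp_add]; simp
    calc y = (exp (-KA) * exp KA) * y := by rw [e, one_mul]
      _ = exp (-KA) * y * exp KA := by ring
      _ ≤ _ := this
  constructor
  · intro t ht
    apply fin
    have h1 := key t ht
    have h2 : 0 ≤ ∫ s in (0 : ℝ)..t, exp (-α s) * D s :=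
      integral_nonneg ht.1 fun s _ => mul_nonneg (exp_pos _).le (D_nonneg s)
    have h3 := mul_le_mul_of_nonneg_right (up t ht) (E_nonneg t)
    have h4 := primitive_le hB B_nonneg ht
    linarith
  · apply fin
    have h1 := key T ⟨hT, le_rfl⟩
    have h2 : 0 ≤ exp (-α T) * E T := mul_nonneg (exp_pos _).le (E_nonneg T)
    have h3 : exp (-KA) * (∫ s in (0 : ℝ)..T, D s) ≤ ∫ s in (0 : ℝ)..T, exp (-α s) * D s := by
      rw [← intervalIntegral.integral_const_mul]
      exact integral_mono_on hT ((hD.const_mul _).intervalIntegrable _ _)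
        (cD.intervalIntegrable _ _)
        fun s hs => mul_le_mul_of_nonneg_right (up s hs) (D_nonneg s)
    linarith

end Gronwall

theorem px_eq_of_hasDerivAt {f : ℝ → ℝ → ℝ} {t x c : ℝ} (h : HasDerivAt (f t) c x) :
    px f t x = c :=
  h.deriv

theorem pt_eq_of_hasDerivAt {f : ℝ → ℝ → ℝ} {t x c : ℝ}
    (h : HasDerivAt (fun s => f s x) c t) : pt f t x = c :=
  h.deriv

theorem deriv_deriv_nonneg_of_isLocalMin {f : ℝ → ℝ} {y c : ℝ} (h : IsLocalMin f y)
    (hc : ContinuousAt f y) (hd : HasDerivAt (deriv f) c y) : 0 ≤ c := by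
  by_contra! hneg
  have hmax : IsLocalMax f y :=
    isLocalMax_of_deriv_deriv_neg (by rwa [hd.deriv]) h.deriv_eq_zero hc
  have hconst : f =ᶠ[𝓝 y] fun _ => f y := by
    filter_upwards [h, hmax] with x h1 h2 using le_antisymm h2 h1
  have h2 : deriv f =ᶠ[𝓝 y] fun _ => 0 := by
    filter_upwards [hconst.eventuallyEq_nhds] with x hx
    rw [hx.deriv_eq, deriv_const]
  have := hd.deriv
  rw [h2.deriv_eq, deriv_const] at this
  linarith

/-- Sign conditions on the parameters of the problem. -/
structure Admissible (μ R a b κ₁ κ₂ β γ T M ε : ℝ) : Prop where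
  μ_pos : 0 < μ
  R_pos : 0 < R
  a_pos : 0 < a
  b_pos : 0 < b
  κ₁_pos : 0 < κ₁
  κ₂_pos : 0 < κ₂
  four_le_β : 4 ≤ β
  one_lt_γ : 1 < γ
  T_pos : 0 < T
  one_le_M : 1 ≤ M
  ε_pos : 0 < ε
  ε_le_one : ε ≤ 1

namespace Admissible

variable {μ R a b κ₁ κ₂ β γ T M ε : ℝ}

theorem cv_pos (P : Admissible μ R a b κ₁ κ₂ β γ T M ε) : 0 < R / (γ - 1) :=
  div_pos P.R_pos (by linarith [P.one_lt_γ])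

end Admissible

namespace Sol

variable {μ R a b κ₁ κ₂ β γ T M ε : ℝ} (S : Sol μ R a b κ₁ κ₂ β γ T)

theorem sp_v : SmoothPeriodic S.v := ⟨S.smooth_v, S.periodic_v⟩

theorem sp_u : SmoothPeriodic S.u := ⟨S.smooth_u, S.periodic_u⟩

theorem sp_θ : SmoothPeriodic S.θ := ⟨S.smooth_θ, S.periodic_θ⟩

theorem sp_q : SmoothPeriodic S.q := ⟨S.smooth_q, S.periodic_q⟩

/-- The heat flux `κ θ_x / v`. -/
def flux (t x : ℝ) : ℝ := kappa κ₁ κ₂ β (S.v t x) (S.θ t x) * px S.θ t x / S.v t x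

/-- The effective stress `μ u_x / v - R θ / v`. -/
def stress (t x : ℝ) : ℝ := μ * px S.u t x / S.v t x - R * S.θ t x / S.v t x

/-- The radiation energy `b θ⁴ - q_x / v`. -/
def rad (t x : ℝ) : ℝ := b * S.θ t x ^ 4 - px S.q t x / S.v t x

/-- The entropy density. -/
def entropy (t x : ℝ) : ℝ := R / (γ - 1) * Real.log (S.θ t x) + R * Real.log (S.v t x)

/-- The total energy density. -/
def energy (t x : ℝ) : ℝ := R / (γ - 1) * S.θ t x + (S.u t x) ^ 2 / 2

theorem sp_kappa : SmoothPeriodic fun t x => kappa κ₁ κ₂ β (S.v t x) (S.θ t x) :=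
  (SmoothPeriodic.const κ₁).add (((SmoothPeriodic.const κ₂).mul S.sp_v).mul
    (S.sp_θ.rpow S.θ_pos β))

theorem sp_flux : SmoothPeriodic S.flux := (S.sp_kappa.mul S.sp_θ.px).div S.sp_v S.v_pos

theorem sp_viscous : SmoothPeriodic fun t x => μ * px S.u t x / S.v t x :=
  ((SmoothPeriodic.const μ).mul S.sp_u.px).div S.sp_v S.v_pos

theorem sp_pressure : SmoothPeriodic fun t x => R * S.θ t x / S.v t x :=
  ((SmoothPeriodic.const R).mul S.sp_θ).div S.sp_v S.v_pos

theorem sp_stress : SmoothPeriodic S.stress := S.sp_viscous.sub S.sp_pressure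

theorem sp_rad : SmoothPeriodic S.rad :=
  ((SmoothPeriodic.const b).mul (S.sp_θ.pow 4)).sub (S.sp_q.px.div S.sp_v S.v_pos)

theorem sp_entropy : SmoothPeriodic S.entropy :=
  ((SmoothPeriodic.const _).mul (S.sp_θ.log S.θ_pos)).add
    ((SmoothPeriodic.const _).mul (S.sp_v.log S.v_pos))

theorem sp_energy : SmoothPeriodic S.energy :=
  ((SmoothPeriodic.const _).mul S.sp_θ).add ((S.sp_u.pow 2).div (SmoothPeriodic.const 2)
    (by norm_num))

variable {S} {t : ℝ}

theorem pt_v (ht : t ∈ Icc 0 T) (x : ℝ) : pt S.v t x = px S.u t x := by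
  linarith [S.eq_mass t ht x]

theorem pt_u (ht : t ∈ Icc 0 T) (x : ℝ) : pt S.u t x = px S.stress t x := by
  have h : px S.stress t x = px (fun s y => μ * px S.u s y / S.v s y) t x
      - px (fun s y => R * S.θ s y / S.v s y) t x :=
    px_eq_of_hasDerivAt ((S.sp_viscous.hasDerivAt_px t x).sub (S.sp_pressure.hasDerivAt_px t x))
  linarith [S.eq_mom t ht x]

theorem px_pressure (S : Sol μ R a b κ₁ κ₂ β γ T) (t x : ℝ) :
    px (fun s y => R * S.θ s y / S.v s y) t x =
      R * px S.θ t x / S.v t x - R * S.θ t x * px S.v t x / S.v t x ^ 2 := by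
  have hv := (S.v_pos t x).ne'
  rw [px_eq_of_hasDerivAt (((S.sp_θ.hasDerivAt_px t x).const_mul R).div
    (S.sp_v.hasDerivAt_px t x) hv)]
  field_simp

theorem px_stress (S : Sol μ R a b κ₁ κ₂ β γ T) (t x : ℝ) :
    px S.stress t x =
      μ * px (px S.u) t x / S.v t x - μ * px S.u t x * px S.v t x / S.v t x ^ 2
        - (R * px S.θ t x / S.v t x - R * S.θ t x * px S.v t x / S.v t x ^ 2) := by
  have hv := (S.v_pos t x).ne'
  rw [px_eq_of_hasDerivAt ((((S.sp_u.px.hasDerivAt_px t x).const_mul μ).div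
    (S.sp_v.hasDerivAt_px t x) hv).sub (((S.sp_θ.hasDerivAt_px t x).const_mul R).div
    (S.sp_v.hasDerivAt_px t x) hv))]
  field_simp

theorem pt_energy (ht : t ∈ Icc 0 T) (x : ℝ) :
    pt S.energy t x = px (fun s y => S.u s y * (μ * px S.u s y / S.v s y) + S.flux s y
      - S.u s y * (R * S.θ s y / S.v s y) - S.q s y) t x := by
  have e := S.eq_energy t ht x
  have h1 := ((((S.sp_u.mul S.sp_viscous).hasDerivAt_px t x).add (S.sp_flux.hasDerivAt_px t x)).sub
    ((S.sp_u.mul S.sp_pressure).hasDerivAt_px t x)).sub (S.sp_q.hasDerivAt_px t x)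
  have h2 := px_eq_of_hasDerivAt (f := fun s y => S.u s y * (μ * px S.u s y / S.v s y)
    + S.flux s y - S.u s y * (R * S.θ s y / S.v s y) - S.q s y) h1
  have e1 : (fun s y => R * S.θ s y / S.v s y * S.u s y)
      = fun s y => S.u s y * (R * S.θ s y / S.v s y) := by ext s y; ring
  have e2 : (fun s y => μ * S.u s y * px S.u s y / S.v s y)
      = fun s y => S.u s y * (μ * px S.u s y / S.v s y) := by ext s y; ring
  rw [e1, e2] at e
  have e3 : px S.flux t x =
    px (fun s y => kappa κ₁ κ₂ β (S.v s y) (S.θ s y) * px S.θ s y / S.v s y) t x := rfl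
  have e4 : pt S.energy t x =
    pt (fun s y => R / (γ - 1) * S.θ s y + (S.u s y) ^ 2 / 2) t x := rfl
  rw [h2, e3, e4]
  linarith

theorem temperature_eq (ht : t ∈ Icc 0 T) (x : ℝ) :
    R / (γ - 1) * pt S.θ t x = px S.flux t x - px S.q t x
      + μ * px S.u t x ^ 2 / S.v t x - R * S.θ t x * px S.u t x / S.v t x := by
  have e := pt_energy (S := S) ht x
  have h1 := (((S.sp_u.hasDerivAt_px t x).mul (S.sp_viscous.hasDerivAt_px t x)).add
    (S.sp_flux.hasDerivAt_px t x)).sub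
    ((S.sp_u.hasDerivAt_px t x).mul (S.sp_pressure.hasDerivAt_px t x))|>.sub
    (S.sp_q.hasDerivAt_px t x)
  have h2 := px_eq_of_hasDerivAt (f := fun s y => S.u s y * (μ * px S.u s y / S.v s y)
    + S.flux s y - S.u s y * (R * S.θ s y / S.v s y) - S.q s y) h1
  have h3 : pt S.energy t x = R / (γ - 1) * pt S.θ t x + S.u t x * pt S.u t x := by
    rw [pt_eq_of_hasDerivAt (f := S.energy)
      (((S.sp_θ.hasDerivAt_pt t x).const_mul (R / (γ - 1))).add
        (((S.sp_u.hasDerivAt_pt t x).fun_pow 2).div_const 2))]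
    norm_num
    ring
  have h4 := S.eq_mom t ht x
  have h5 : S.u t x * pt S.u t x = S.u t x * (px (fun s y => μ * px S.u s y / S.v s y) t x
      - px (fun s y => R * S.θ s y / S.v s y) t x) := by
    congr 1; linarith
  rw [h3, h2, h5] at e
  have h6 : μ * px S.u t x ^ 2 / S.v t x = px S.u t x * (μ * px S.u t x / S.v t x) := by ring
  have h7 : R * S.θ t x * px S.u t x / S.v t x = px S.u t x * (R * S.θ t x / S.v t x) := by ring
  rw [h6, h7]
  linarith

theorem px_rad (ht : t ∈ Icc 0 T) (x : ℝ) : px S.rad t x = -(a * S.v t x * S.q t x) := by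
  have h4 : SmoothPeriodic fun s y => (S.θ s y) ^ 4 := S.sp_θ.pow 4
  have h : px S.rad t x = b * px (fun s y => (S.θ s y) ^ 4) t x
      - px (fun s y => px S.q s y / S.v s y) t x :=
    px_eq_of_hasDerivAt (((h4.hasDerivAt_px t x).const_mul b).sub
      ((S.sp_q.px.div S.sp_v S.v_pos).hasDerivAt_px t x))
  linarith [S.eq_rad t ht x]

theorem px_q (S : Sol μ R a b κ₁ κ₂ β γ T) (t x : ℝ) :
    px S.q t x = S.v t x * (b * S.θ t x ^ 4 - S.rad t x) := by
  have hv := (S.v_pos t x).ne'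
  simp only [rad]
  field_simp
  ring

theorem px_px_rad (ht : t ∈ Icc 0 T) (x : ℝ) :
    HasDerivAt (px S.rad t) (-(a * px S.v t x * S.q t x + a * S.v t x * px S.q t x)) x := by
  have e : px S.rad t = fun y => -(a * S.v t y * S.q t y) := funext fun y => px_rad ht y
  rw [e]
  exact (((S.sp_v.hasDerivAt_px t x).const_mul a).mul (S.sp_q.hasDerivAt_px t x)).neg

theorem exists_isMin {f : ℝ → ℝ} (hf : Continuous f) (hp : Function.Periodic f 1) :
    ∃ y, ∀ x, f y ≤ f x := by
  obtain ⟨y, -, hm⟩ := isCompact_Icc.exists_isMinOn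
    (nonempty_Icc.2 (by norm_num : (-(1 / 2) : ℝ) ≤ 1 / 2)) hf.continuousOn
  refine ⟨y, fun x => ?_⟩
  obtain ⟨z, hz, e⟩ := exists_mem_period x hp
  rw [e]
  exact hm hz

/-- Minimum principle for the radiation energy. -/
theorem exists_le_rad (P : Admissible μ R a b κ₁ κ₂ β γ T M ε) (ht : t ∈ Icc 0 T) :
    ∃ y, ∀ x, b * S.θ t y ^ 4 ≤ S.rad t x := by
  obtain ⟨y, hy⟩ := exists_isMin (S.sp_rad.cont t) (S.sp_rad.periodic t)
  refine ⟨y, fun x => le_trans ?_ (hy x)⟩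
  have hmin : IsLocalMin (S.rad t) y := Eventually.of_forall hy
  have h0 : px S.rad t y = 0 := hmin.deriv_eq_zero
  have h2 := deriv_deriv_nonneg_of_isLocalMin hmin (S.sp_rad.cont t).continuousAt
    (px_px_rad (S := S) ht y)
  rw [px_rad ht y] at h0
  have hv := S.v_pos t y
  have hav := mul_pos P.a_pos hv
  have hq : S.q t y = 0 := by
    rcases mul_eq_zero.1 (neg_eq_zero.1 h0) with h | h
    · exact absurd h hav.ne'
    · exact h
  rw [hq] at h2
  have hqx : px S.q t y ≤ 0 := by
    by_contra! h
    nlinarith [mul_pos hav h]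
  have := div_nonpos_of_nonpos_of_nonneg hqx hv.le
  simp only [rad]
  linarith

/-- Maximum principle for the radiation energy. -/
theorem exists_rad_le (P : Admissible μ R a b κ₁ κ₂ β γ T M ε) (ht : t ∈ Icc 0 T) :
    ∃ y, ∀ x, S.rad t x ≤ b * S.θ t y ^ 4 := by
  obtain ⟨y, hy⟩ := exists_isMin (S.sp_rad.cont t).neg
    (fun x => congrArg Neg.neg (S.sp_rad.periodic t x))
  refine ⟨y, fun x => le_trans (neg_le_neg_iff.1 (hy x)) ?_⟩
  have hmin : IsLocalMin (fun z => -S.rad t z) y := Eventually.of_forall hy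
  have hd : ∀ z, HasDerivAt (fun z => -S.rad t z) (-px S.rad t z) z :=
    fun z => (S.sp_rad.hasDerivAt_px t z).neg
  have h0 : -px S.rad t y = 0 := by rw [← (hd y).deriv]; exact hmin.deriv_eq_zero
  have h2 := deriv_deriv_nonneg_of_isLocalMin hmin (S.sp_rad.cont t).neg.continuousAt
    (by rw [funext fun z => (hd z).deriv]; exact (px_px_rad (S := S) ht y).neg)
  rw [px_rad ht y, neg_neg] at h0
  have hv := S.v_pos t y
  have hav := mul_pos P.a_pos hv
  have hq : S.q t y = 0 := by
    rcases mul_eq_zero.1 h0 with h | h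
    · exact absurd h hav.ne'
    · exact h
  rw [hq] at h2
  have hqx : 0 ≤ px S.q t y := by
    by_contra! h
    nlinarith [mul_neg_of_pos_of_neg hav h]
  have := div_nonneg hqx hv.le
  simp only [rad]
  linarith

theorem rad_pos (P : Admissible μ R a b κ₁ κ₂ β γ T M ε) (ht : t ∈ Icc 0 T) (x : ℝ) :
    0 < S.rad t x := by
  obtain ⟨y, hy⟩ := exists_le_rad (S := S) P ht
  exact (mul_pos P.b_pos (pow_pos (S.θ_pos t y) 4)).trans_le (hy x)

/-- The radiative entropy production is nonnegative. -/
theorem tInt_px_q_div_θ_nonpos (P : Admissible μ R a b κ₁ κ₂ β γ T M ε) (ht : t ∈ Icc 0 T) :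
    tInt (fun x => px S.q t x / S.θ t x) ≤ 0 := by
  have hb := P.b_pos
  have hn : ∀ x, 0 < S.rad t x / b := fun x => div_pos (rad_pos P ht x) hb
  set φ : ℝ → ℝ := fun x => (S.rad t x / b) ^ (1 / 4 : ℝ) with hφ
  have φ_pos : ∀ x, 0 < φ x := fun x => rpow_pos_of_pos (hn x) _
  have φ4 : ∀ x, S.rad t x = b * φ x ^ 4 := fun x => by
    rw [hφ]
    simp only
    rw [← Real.rpow_natCast, ← Real.rpow_mul (hn x).le]
    norm_num
    field_simp
  have dφ : ∀ x, HasDerivAt φ (px S.rad t x / b * (1 / 4) * (S.rad t x / b) ^ (1 / 4 - 1 : ℝ)) x :=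
    fun x => ((S.sp_rad.hasDerivAt_px t x).div_const b).rpow_const (Or.inl (hn x).ne')
  have cn := S.sp_rad.cont t
  have cnx := S.sp_rad.px.cont t
  have cq := S.sp_q.cont t
  have cqx := S.sp_q.px.cont t
  have cφ : Continuous φ := continuous_iff_continuousAt.2 fun x => (dφ x).continuousAt
  have cr : Continuous fun x => (S.rad t x / b) ^ (1 / 4 - 1 : ℝ) :=
    (cn.div_const b).rpow_const fun x => Or.inl (hn x).ne'
  have cφ' : Continuous fun x =>
      px S.rad t x / b * (1 / 4) * (S.rad t x / b) ^ (1 / 4 - 1 : ℝ) := by fun_prop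
  have df := fun x => (S.sp_q.hasDerivAt_px t x).div (dφ x) (φ_pos x).ne'
  have cf' : Continuous fun x => (px S.q t x * φ x - S.q t x *
      (px S.rad t x / b * (1 / 4) * (S.rad t x / b) ^ (1 / 4 - 1 : ℝ))) / φ x ^ 2 :=
    ((cqx.mul cφ).sub (cq.mul cφ')).div (cφ.pow 2) fun x => (pow_pos (φ_pos x) 2).ne'
  rw [← tInt_deriv_eq_zero df cf' (fun x => by
    simp only [hφ, Pi.div_apply, S.sp_q.periodic t x, S.sp_rad.periodic t x])]
  refine tInt_mono (cqx.div (S.sp_θ.cont t) fun x => (S.θ_pos t x).ne') cf' fun x => ?_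
  have hr : 0 < (S.rad t x / b) ^ (1 / 4 - 1 : ℝ) := rpow_pos_of_pos (hn x) _
  have hv := S.v_pos t x
  have hθ := S.θ_pos t x
  have hp := φ_pos x
  have s1 : px S.q t x / S.θ t x ≤ px S.q t x / φ x := by
    have e : px S.q t x = S.v t x * b * ((S.θ t x - φ x) *
        ((S.θ t x + φ x) * (S.θ t x ^ 2 + φ x ^ 2))) := by
      rw [px_q, φ4]; ring
    have e2 : px S.q t x / φ x - px S.q t x / S.θ t x = S.v t x * b * ((S.θ t x - φ x) ^ 2 *
        ((S.θ t x + φ x) * (S.θ t x ^ 2 + φ x ^ 2))) / (φ x * S.θ t x) := by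
      rw [e]; field_simp
    have : 0 ≤ px S.q t x / φ x - px S.q t x / S.θ t x := by
      rw [e2]; positivity
    linarith
  refine s1.trans ?_
  have s2 : -(S.q t x * (px S.rad t x / b * (1 / 4) * (S.rad t x / b) ^ (1 / 4 - 1 : ℝ)))
      = a * S.v t x * S.q t x ^ 2 * (1 / 4) * (S.rad t x / b) ^ (1 / 4 - 1 : ℝ) / b := by
    rw [px_rad ht]; ring
  have s3 : 0 ≤ a * S.v t x * S.q t x ^ 2 * (1 / 4) * (S.rad t x / b) ^ (1 / 4 - 1 : ℝ) / b := by
    have := P.a_pos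
    positivity
  rw [div_le_div_iff₀ hp (pow_pos hp 2)]
  nlinarith

theorem Bounded.data_le (hM : 1 ≤ M) (hS : S.Bounded M ε) :
    tInt (fun x => px S.v 0 x ^ 2) ≤ M ^ 2 ∧ tInt (fun x => S.u 0 x ^ 2) ≤ M ^ 2 ∧
      tInt (fun x => px S.u 0 x ^ 2) ≤ M ^ 2 ∧ tInt (fun x => S.θ 0 x ^ 2) ≤ M ^ 2 ∧
      tInt (fun x => px S.θ 0 x ^ 2) ≤ M ^ 2 := by
  have nn : ∀ f : ℝ → ℝ, 0 ≤ L2sq f := fun f => tInt_nonneg fun x => sq_nonneg _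
  have h := hS.1
  rw [Real.sqrt_le_left (by linarith)] at h
  simp only [H2sq] at h
  change L2sq (deriv (S.v 0)) ≤ _ ∧ L2sq (S.u 0) ≤ _ ∧ L2sq (deriv (S.u 0)) ≤ _ ∧
    L2sq (S.θ 0) ≤ _ ∧ L2sq (deriv (S.θ 0)) ≤ _
  have := nn (S.v 0)
  have := nn (deriv (S.v 0))
  have := nn (deriv (deriv (S.v 0)))
  have := nn (S.u 0)
  have := nn (deriv (S.u 0))
  have := nn (deriv (deriv (S.u 0)))
  have := nn (S.θ 0)
  have := nn (deriv (S.θ 0))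
  have := nn (deriv (deriv (S.θ 0)))
  refine ⟨?_, ?_, ?_, ?_, ?_⟩ <;> linarith

theorem tInt_v (ht : t ∈ Icc 0 T) : tInt (S.v t) = 1 := by
  have hd : ∀ s ∈ Icc 0 T, tInt (pt S.v s) = 0 := fun s hs => by
    rw [funext fun x => pt_v (S := S) hs x]; exact S.sp_u.tInt_px s
  have h1 := monotone_of_deriv_le (fun s _ => S.sp_v.hasDerivAt_tInt s)
    (fun s hs => (hd s hs).le) ht
  have h2 := monotone_of_deriv_le (fun s _ => (S.sp_v.hasDerivAt_tInt s).neg)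
    (fun s hs => by rw [hd s hs, neg_zero]) ht
  rw [← S.mean_v]
  simp only [Pi.neg_apply] at h2
  exact le_antisymm h1 (neg_le_neg_iff.1 h2)

theorem tInt_energy_le (ht : t ∈ Icc 0 T) : tInt (S.energy t) ≤ tInt (S.energy 0) := by
  refine monotone_of_deriv_le (fun s _ => S.sp_energy.hasDerivAt_tInt s) (fun s hs => ?_) ht
  rw [funext fun x => pt_energy (S := S) hs x]
  exact ((((S.sp_u.mul S.sp_viscous).add S.sp_flux).sub
    (S.sp_u.mul S.sp_pressure)).sub S.sp_q).tInt_px s |>.le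

theorem energy_bound (P : Admissible μ R a b κ₁ κ₂ β γ T M ε) :
    ∃ C, 0 < C ∧ ∀ S : Sol μ R a b κ₁ κ₂ β γ T, S.Bounded M ε → ∀ t ∈ Icc 0 T,
      tInt (S.θ t) ≤ C ∧ tInt (fun x => S.u t x ^ 2) ≤ C := by
  set c := R / (γ - 1) with hc
  have c_pos : 0 < c := P.cv_pos
  set K := c * M ^ 2 + 1 / 2 * M ^ 2 + c with hK
  have K_pos : 0 < K := by positivity
  refine ⟨1 / c * K + 2 * K, by positivity, fun S hS t ht => ?_⟩
  obtain ⟨-, hu, -, hθ, -⟩ := hS.data_le P.one_le_M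
  have cθ := S.sp_θ.cont
  have cu := S.sp_u.cont
  have ce := S.sp_energy.cont
  have e0 : tInt (S.energy 0) ≤ K := by
    have := tInt_le_combination (c₁ := c) (c₂ := 1 / 2) (c₃ := 0) (c₄ := c) (ce 0)
      ((cθ 0).pow 2) ((cu 0).pow 2) (cu 0) (fun x => by
        have : S.energy 0 x = c * S.θ 0 x + S.u 0 x ^ 2 / 2 := rfl
        simp only [Pi.pow_apply]
        nlinarith [sq_nonneg (S.θ 0 x - 1), sq_nonneg (S.θ 0 x)])
    refine this.trans ?_
    have h1 := mul_le_mul_of_nonneg_left hθ c_pos.le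
    simp only [Pi.pow_def]
    linarith
  have e1 := (tInt_energy_le (S := S) ht).trans e0
  have e2 : ∀ x, S.energy t x = c * S.θ t x + S.u t x ^ 2 / 2 := fun x => rfl
  have p1 : 0 ≤ 1 / c * K := by positivity
  constructor
  · have h : tInt (S.θ t) ≤ 1 / c * tInt (S.energy t) := by
      rw [← tInt_const_mul]
      refine tInt_mono (cθ t) ((ce t).const_mul _) fun x => ?_
      rw [e2, mul_add, ← mul_assoc, one_div_mul_cancel c_pos.ne', one_mul]
      have : 0 ≤ 1 / c * (S.u t x ^ 2 / 2) := by positivity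
      linarith
    have := mul_le_mul_of_nonneg_left e1 (by positivity : 0 ≤ 1 / c)
    linarith
  · have h : tInt (fun x => S.u t x ^ 2) ≤ 2 * tInt (S.energy t) := by
      rw [← tInt_const_mul]
      refine tInt_mono ((cu t).pow 2) ((ce t).const_mul _) fun x => ?_
      rw [e2]
      have := mul_pos c_pos (S.θ_pos t x)
      linarith
    linarith

variable (S) in
/-- The density of the entropy dissipation due to heat conduction. -/
def dissDensity (t x : ℝ) : ℝ := S.flux t x * px S.θ t x / S.θ t x ^ 2

variable (S) in
/-- The entropy dissipation due to heat conduction. -/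
def diss (t : ℝ) : ℝ := tInt (S.dissDensity t)

theorem sp_dissDensity (S : Sol μ R a b κ₁ κ₂ β γ T) : SmoothPeriodic S.dissDensity :=
  (S.sp_flux.mul S.sp_θ.px).div (S.sp_θ.pow 2) fun t x => pow_pos (S.θ_pos t x) 2

theorem kappa_pos (P : Admissible μ R a b κ₁ κ₂ β γ T M ε) (t x : ℝ) :
    0 < kappa κ₁ κ₂ β (S.v t x) (S.θ t x) := by
  have := rpow_pos_of_pos (S.θ_pos t x) β
  have := S.v_pos t x
  have := P.κ₁_pos
  have := P.κ₂_pos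
  simp only [kappa]
  positivity

theorem dissDensity_eq (S : Sol μ R a b κ₁ κ₂ β γ T) (t x : ℝ) :
    S.dissDensity t x = (κ₁ / S.v t x + κ₂ * S.θ t x ^ β) * (px S.θ t x ^ 2 / S.θ t x ^ 2) := by
  have := S.v_pos t x
  have := S.θ_pos t x
  simp only [dissDensity, flux, kappa]
  field_simp

theorem dissDensity_nonneg (P : Admissible μ R a b κ₁ κ₂ β γ T M ε) (t x : ℝ) :
    0 ≤ S.dissDensity t x := by
  have := rpow_pos_of_pos (S.θ_pos t x) β
  have := S.v_pos t x
  have := P.κ₁_pos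
  have := P.κ₂_pos
  rw [dissDensity_eq]
  positivity

theorem diss_nonneg (P : Admissible μ R a b κ₁ κ₂ β γ T M ε) (t : ℝ) : 0 ≤ S.diss t :=
  tInt_nonneg fun x => dissDensity_nonneg P t x

theorem continuous_diss (S : Sol μ R a b κ₁ κ₂ β γ T) : Continuous S.diss :=
  S.sp_dissDensity.continuous_tInt

theorem diss_le_tInt_pt_entropy (P : Admissible μ R a b κ₁ κ₂ β γ T M ε) (ht : t ∈ Icc 0 T) :
    S.diss t ≤ tInt (pt S.entropy t) := by
  have hs : ∀ x, pt S.entropy t x = R / (γ - 1) * pt S.θ t x / S.θ t x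
      + R * px S.u t x / S.v t x := fun x => by
    rw [pt_eq_of_hasDerivAt (f := S.entropy)
      ((((S.sp_θ.hasDerivAt_pt t x).log (S.θ_pos t x).ne').const_mul (R / (γ - 1))).add
        (((S.sp_v.hasDerivAt_pt t x).log (S.v_pos t x).ne').const_mul R)), pt_v ht]
    ring
  have hg : SmoothPeriodic fun s y => S.flux s y / S.θ s y := S.sp_flux.div S.sp_θ S.θ_pos
  have hr : SmoothPeriodic fun s y => px S.q s y / S.θ s y := S.sp_q.px.div S.sp_θ S.θ_pos
  have hgx : ∀ x, px (fun s y => S.flux s y / S.θ s y) t x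
      = px S.flux t x / S.θ t x - S.dissDensity t x := fun x => by
    have := S.θ_pos t x
    rw [px_eq_of_hasDerivAt ((S.sp_flux.hasDerivAt_px t x).div
      (S.sp_θ.hasDerivAt_px t x) (S.θ_pos t x).ne')]
    simp only [dissDensity]
    field_simp
  have key := tInt_le_combination (c₁ := 1) (c₂ := 1) (c₃ := -1) (c₄ := 0)
    (S.sp_dissDensity.cont t) (S.sp_entropy.pt.cont t) (hr.cont t) (hg.px.cont t) (fun x => by
      have hθ := S.θ_pos t x
      have hv := S.v_pos t x
      have hp : 0 ≤ μ * px S.u t x ^ 2 / S.v t x / S.θ t x := by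
        have := P.μ_pos
        positivity
      rw [hs, hgx, temperature_eq ht]
      have : (px S.flux t x - px S.q t x + μ * px S.u t x ^ 2 / S.v t x
          - R * S.θ t x * px S.u t x / S.v t x) / S.θ t x
          = px S.flux t x / S.θ t x - px S.q t x / S.θ t x
            + μ * px S.u t x ^ 2 / S.v t x / S.θ t x - R * px S.u t x / S.v t x := by
        field_simp
      rw [this]
      linarith)
  rw [hg.tInt_px] at key
  have := tInt_px_q_div_θ_nonpos (S := S) P ht
  simp only [diss]
  linarith

theorem diss_bound (P : Admissible μ R a b κ₁ κ₂ β γ T M ε) :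
    ∃ C, 0 < C ∧ ∀ S : Sol μ R a b κ₁ κ₂ β γ T, S.Bounded M ε →
      (∫ s in (0 : ℝ)..T, S.diss s) ≤ C := by
  obtain ⟨CE, CE_pos, hE⟩ := energy_bound P
  set c := R / (γ - 1) with hc
  have c_pos : 0 < c := P.cv_pos
  have hR := P.R_pos
  have hl : Real.log ε ≤ 0 := Real.log_nonpos P.ε_pos.le P.ε_le_one
  refine ⟨c * CE + R - (c + R) * Real.log ε, by nlinarith, fun S hS => ?_⟩
  have hT : T ∈ Icc 0 T := ⟨P.T_pos.le, le_rfl⟩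
  have key := monotone_of_deriv_le (T := T)
    (fun s _ => (hasDerivAt_primitive S.continuous_diss s).sub (S.sp_entropy.hasDerivAt_tInt s))
    (fun s hs => sub_nonpos.2 (diss_le_tInt_pt_entropy P hs)) hT
  simp only [Pi.sub_apply, intervalIntegral.integral_same] at key
  have up : tInt (S.entropy T) ≤ c * tInt (S.θ T) + R * tInt (S.v T) + 0 * tInt (S.v T) + 0 :=
    tInt_le_combination (S.sp_entropy.cont T) (S.sp_θ.cont T) (S.sp_v.cont T) (S.sp_v.cont T)
      fun x => by
        have h1 := Real.log_le_sub_one_of_pos (S.θ_pos T x)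
        have h2 := Real.log_le_sub_one_of_pos (S.v_pos T x)
        have : S.entropy T x = c * Real.log (S.θ T x) + R * Real.log (S.v T x) := rfl
        nlinarith
  have lo : (c + R) * Real.log ε ≤ tInt (S.entropy 0) := by
    rw [← tInt_const ((c + R) * Real.log ε)]
    refine tInt_mono continuous_const (S.sp_entropy.cont 0) fun x => ?_
    have h1 := Real.log_le_log P.ε_pos (hS.2.1 x)
    have h2 := Real.log_le_log P.ε_pos (hS.2.2 x)
    have : S.entropy 0 x = c * Real.log (S.θ 0 x) + R * Real.log (S.v 0 x) := rfl
    nlinarith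
  rw [tInt_v hT] at up
  have := mul_le_mul_of_nonneg_left (hE S hS T hT).1 c_pos.le
  linarith

/-- Pointwise control of the temperature by the entropy dissipation. -/
theorem θ_sq_le_diss (P : Admissible μ R a b κ₁ κ₂ β γ T M ε) :
    ∃ C, 1 ≤ C ∧ ∀ S : Sol μ R a b κ₁ κ₂ β γ T, S.Bounded M ε → ∀ t ∈ Icc 0 T, ∀ x,
      S.θ t x ^ 2 ≤ C * (1 + S.diss t) := by
  obtain ⟨CE, CE_pos, hE⟩ := energy_bound P
  have hβ := P.four_le_β
  have hκ := P.κ₂_pos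
  have hC := rpow_pos_of_pos CE_pos (β / 2)
  have hq : 0 < β / (2 * κ₂) := by positivity
  refine ⟨1 + CE ^ (β / 2) + β / 2 + β / (2 * κ₂), by linarith, fun S hS t ht x => ?_⟩
  obtain ⟨x', hx', ex⟩ := exists_mem_period x (S.sp_θ.periodic t)
  rw [ex]
  obtain ⟨y, hy, hle⟩ := exists_le_tInt (S.sp_θ.cont t)
  have hθ := S.θ_pos t
  have cθ := S.sp_θ.cont t
  have cθx := S.sp_θ.px.cont t
  have cr : ∀ r : ℝ, Continuous fun x => S.θ t x ^ r := fun r =>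
    cθ.rpow_const fun x => Or.inl (hθ x).ne'
  have cd := S.sp_dissDensity.cont t
  have hd : ∀ x, HasDerivAt (fun x => S.θ t x ^ (β / 2))
      (px S.θ t x * (β / 2) * S.θ t x ^ (β / 2 - 1)) x := fun x =>
    (S.sp_θ.hasDerivAt_px t x).rpow_const (Or.inl (hθ x).ne')
  have key := sub_le_tInt hd (by fun_prop)
    (g := fun x => β / (2 * κ₂) * S.dissDensity t x + 0 * S.θ t x + 0 * S.θ t x + β / 2)
    (by fun_prop) (fun x => by
      have e1 : (S.θ t x ^ (β / 2 - 1)) ^ 2 = S.θ t x ^ β / S.θ t x ^ 2 := by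
        rw [← Real.rpow_natCast, ← Real.rpow_mul (hθ x).le, ← Real.rpow_natCast,
          ← Real.rpow_sub (hθ x)]
        congr 1
        push_cast
        ring
      set w := S.θ t x ^ (β / 2 - 1)
      have e2 : κ₂ * (px S.θ t x * w) ^ 2 ≤ S.dissDensity t x := by
        rw [mul_pow, e1, dissDensity_eq]
        have h1 : 0 ≤ κ₁ / S.v t x * (px S.θ t x ^ 2 / S.θ t x ^ 2) := by
          have := P.κ₁_pos
          have := S.v_pos t x
          positivity
        have h2 : κ₂ * (px S.θ t x ^ 2 * (S.θ t x ^ β / S.θ t x ^ 2))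
          = κ₂ * S.θ t x ^ β * (px S.θ t x ^ 2 / S.θ t x ^ 2) := by ring
        rw [h2, add_mul]
        linarith
      set z := px S.θ t x * w with hz
      have e3 : px S.θ t x * (β / 2) * w = β / 2 * z := by rw [hz]; ring
      have e4 : z ^ 2 ≤ S.dissDensity t x / κ₂ := by
        rw [le_div_iff₀ hκ]; linarith
      have e5 : |z| ≤ z ^ 2 + 1 := by
        rw [abs_le]; constructor <;> nlinarith [sq_nonneg (z - 1), sq_nonneg (z + 1)]
      rw [e3, abs_mul, abs_of_pos (by linarith : 0 < β / 2)]
      have e6 : β / (2 * κ₂) * S.dissDensity t x = β / 2 * (S.dissDensity t x / κ₂) := by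
        field_simp
      rw [e6]
      have := mul_le_mul_of_nonneg_left (e5.trans (add_le_add_left e4 1))
        (by linarith : 0 ≤ β / 2)
      linarith) hx' hy
  rw [tInt_combination cd cθ cθ] at key
  have hyw : S.θ t y ^ (β / 2) ≤ CE ^ (β / 2) :=
    Real.rpow_le_rpow (hθ y).le (hle.trans (hE S hS t ht).1) (by linarith)
  have hx2 : S.θ t x' ^ 2 ≤ 1 + S.θ t x' ^ (β / 2) := by
    have hp := rpow_pos_of_pos (hθ x') (β / 2)
    rcases le_total (S.θ t x') 1 with h | h
    · nlinarith [hθ x']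
    · have := Real.rpow_le_rpow_of_exponent_le h (by linarith : (2 : ℝ) ≤ β / 2)
      rw [Real.rpow_two] at this
      linarith
  have hD : 0 ≤ S.diss t := diss_nonneg P t
  have e : tInt (S.dissDensity t) = S.diss t := rfl
  rw [e] at key
  nlinarith [mul_nonneg (by linarith : 0 ≤ 1 + CE ^ (β / 2) + β / 2) hD]

end Sol

theorem tInt_mono_on {f g : ℝ → ℝ} (hf : Continuous f) (hg : Continuous g)
    (hfg : ∀ x ∈ Icc (-(1 / 2) : ℝ) (1 / 2), f x ≤ g x) : tInt f ≤ tInt g :=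
  intervalIntegral.integral_mono_on (by norm_num) (hf.intervalIntegrable _ _)
    (hg.intervalIntegrable _ _) hfg

namespace Sol

variable {μ R a b κ₁ κ₂ β γ T M ε : ℝ} {S : Sol μ R a b κ₁ κ₂ β γ T} {t : ℝ}

theorem θ_le_diss (P : Admissible μ R a b κ₁ κ₂ β γ T M ε) :
    ∃ C, 1 ≤ C ∧ ∀ S : Sol μ R a b κ₁ κ₂ β γ T, S.Bounded M ε → ∀ t ∈ Icc 0 T, ∀ x,
      S.θ t x ≤ C * (1 + S.diss t) := by
  obtain ⟨C, hC, h⟩ := θ_sq_le_diss P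
  refine ⟨1 + C, by linarith, fun S hS t ht x => ?_⟩
  have := h S hS t ht x
  have := diss_nonneg (S := S) P t
  nlinarith [sq_nonneg (S.θ t x - 1), sq_nonneg (S.θ t x)]

variable (S) in
/-- The velocity potential `∫₀ˣ u`. -/
def pot (t x : ℝ) : ℝ := ∫ y in (0 : ℝ)..x, S.u t y

variable (S) in
/-- The time integral of the stress at the origin. -/
def stressInt (t : ℝ) : ℝ := ∫ s in (0 : ℝ)..t, S.stress s 0

variable (S) in
/-- The specific volume, renormalized so that its time derivative is nonnegative. -/
def renorm (t x : ℝ) : ℝ :=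
  S.v t x * (exp (-(S.pot t x) / μ) * exp (-(S.stressInt t) / μ))

variable (S) in
/-- The time derivative of `Sol.renorm`. -/
def renormDeriv (t x : ℝ) : ℝ :=
  (pt S.v t x - S.v t x * ((∫ y in (0 : ℝ)..x, pt S.u t y) + S.stress t 0) / μ) *
    (exp (-(S.pot t x) / μ) * exp (-(S.stressInt t) / μ))

theorem continuous_stress_zero (S : Sol μ R a b κ₁ κ₂ β γ T) :
    Continuous fun s => S.stress s 0 :=
  S.sp_stress.joint.comp (Continuous.prodMk continuous_id continuous_const)

theorem hasDerivAt_stressInt (S : Sol μ R a b κ₁ κ₂ β γ T) (t : ℝ) :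
    HasDerivAt S.stressInt (S.stress t 0) t :=
  hasDerivAt_primitive (continuous_stress_zero S) t

theorem continuous_stressInt (S : Sol μ R a b κ₁ κ₂ β γ T) : Continuous S.stressInt :=
  continuous_iff_continuousAt.2 fun t => (hasDerivAt_stressInt S t).continuousAt

theorem continuous_primitive {f : ℝ → ℝ → ℝ} (hf : Continuous fun p : ℝ × ℝ => f p.1 p.2) :
    Continuous fun p : ℝ × ℝ => ∫ y in (0 : ℝ)..p.2, f p.1 y :=
  intervalIntegral.continuous_parametric_intervalIntegral_of_continuous
    (f := fun (p : ℝ × ℝ) y => f p.1 y)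
    (hf.comp ((continuous_fst.comp continuous_fst).prodMk continuous_snd)) continuous_snd

theorem continuous_pot (S : Sol μ R a b κ₁ κ₂ β γ T) :
    Continuous fun p : ℝ × ℝ => S.pot p.1 p.2 :=
  continuous_primitive S.sp_u.joint

theorem continuous_renorm (S : Sol μ R a b κ₁ κ₂ β γ T) :
    Continuous fun p : ℝ × ℝ => S.renorm p.1 p.2 := by
  have h1 := S.sp_v.joint
  have h2 := continuous_pot S
  have h3 := (continuous_stressInt S).comp (continuous_fst (X := ℝ) (Y := ℝ))
  simp only [Function.comp_def] at h3
  unfold renorm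
  fun_prop

theorem continuous_renormDeriv (S : Sol μ R a b κ₁ κ₂ β γ T) :
    Continuous fun p : ℝ × ℝ => S.renormDeriv p.1 p.2 := by
  have h1 := S.sp_v.joint
  have h2 := continuous_pot S
  have h3 := (continuous_stressInt S).comp (continuous_fst (X := ℝ) (Y := ℝ))
  have h4 := S.sp_v.pt.joint
  have h5 := continuous_primitive S.sp_u.pt.joint
  have h6 := (continuous_stress_zero S).comp (continuous_fst (X := ℝ) (Y := ℝ))
  simp only [Function.comp_def] at h3 h6
  unfold renormDeriv
  fun_prop

theorem hasDerivAt_renorm (S : Sol μ R a b κ₁ κ₂ β γ T) (t x : ℝ) :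
    HasDerivAt (fun s => S.renorm s x) (S.renormDeriv t x) t := by
  have hp : HasDerivAt (fun s => S.pot s x) (∫ y in (0 : ℝ)..x, pt S.u t y) t :=
    hasDerivAt_integral_param S.sp_u.cont S.sp_u.pt.joint
      (fun t x => S.sp_u.hasDerivAt_pt t x) 0 x t
  refine ((S.sp_v.hasDerivAt_pt t x).mul ((hp.neg.div_const μ).exp.mul
    ((hasDerivAt_stressInt S t).neg.div_const μ).exp)).congr_deriv ?_
  simp only [renormDeriv, Pi.mul_apply, Pi.neg_apply]
  ring

theorem renormDeriv_eq (P : Admissible μ R a b κ₁ κ₂ β γ T M ε) (ht : t ∈ Icc 0 T) (x : ℝ) :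
    S.renormDeriv t x =
      R / μ * S.θ t x * (exp (-(S.pot t x) / μ) * exp (-(S.stressInt t) / μ)) := by
  have h : (∫ y in (0 : ℝ)..x, pt S.u t y) = S.stress t x - S.stress t 0 := by
    rw [funext fun y => pt_u (S := S) ht y]
    exact intervalIntegral.integral_eq_sub_of_hasDerivAt
      (fun y _ => S.sp_stress.hasDerivAt_px t y) ((S.sp_stress.px.cont t).intervalIntegrable _ _)
  have hμ := P.μ_pos
  have hv := S.v_pos t x
  rw [renormDeriv, h, pt_v ht]
  congr 1
  simp only [stress]
  field_simp
  ring

theorem abs_pot_le {C : ℝ} (hC : tInt (fun x => S.u t x ^ 2) ≤ C) {x : ℝ}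
    (hx : x ∈ Icc (-(1 / 2) : ℝ) (1 / 2)) : |S.pot t x| ≤ C + 1 := by
  have cu := S.sp_u.cont t
  have hd : ∀ x, HasDerivAt (S.pot t) (S.u t x) x := hasDerivAt_primitive cu
  have h0 : S.pot t 0 = 0 := intervalIntegral.integral_same
  have hm : (0 : ℝ) ∈ Icc (-(1 / 2) : ℝ) (1 / 2) := by norm_num
  have cg : Continuous fun x => S.u t x ^ 2 + 1 := by fun_prop
  have hg : ∀ x, |S.u t x| ≤ S.u t x ^ 2 + 1 := fun x => by
    rw [abs_le]
    constructor <;> nlinarith [sq_nonneg (S.u t x - 1), sq_nonneg (S.u t x + 1)]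
  have h1 := sub_le_tInt hd cu cg hg hx hm
  have h2 := sub_le_tInt hd cu cg hg hm hx
  rw [tInt_add (by fun_prop) continuous_const, tInt_const] at h1 h2
  rw [abs_le]
  constructor <;> linarith

theorem exp_bounds {p C : ℝ} (hμ : 0 < μ) (h : |p| ≤ C) :
    exp (-(C / μ)) ≤ exp (-p / μ) ∧ exp (-p / μ) ≤ exp (C / μ) := by
  rw [abs_le] at h
  constructor <;> rw [exp_le_exp]
  · rw [← neg_div]
    exact div_le_div_of_nonneg_right (by linarith) hμ.le
  · exact div_le_div_of_nonneg_right (by linarith) hμ.le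

theorem data_v_le (P : Admissible μ R a b κ₁ κ₂ β γ T M ε) (hS : S.Bounded M ε) (x : ℝ) :
    S.v 0 x ≤ M ^ 2 + 2 := by
  have c := S.sp_v.px.cont 0
  have h := le_tInt_add_tInt (S.sp_v.hasDerivAt_px 0) c (S.sp_v.periodic 0)
    (g := fun x => px S.v 0 x ^ 2 + 1) (by fun_prop) (fun x => by
      rw [abs_le]
      constructor <;> nlinarith [sq_nonneg (px S.v 0 x - 1), sq_nonneg (px S.v 0 x + 1)]) x
  rw [tInt_add (by fun_prop) continuous_const, tInt_const, tInt_v ⟨le_rfl, P.T_pos.le⟩] at h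
  have := (hS.data_le P.one_le_M).1
  linarith

/-- Upper and lower bounds for the specific volume. -/
theorem v_bounds (P : Admissible μ R a b κ₁ κ₂ β γ T M ε) :
    ∃ c C, 0 < c ∧ 0 < C ∧ ∀ S : Sol μ R a b κ₁ κ₂ β γ T, S.Bounded M ε → ∀ t ∈ Icc 0 T, ∀ x,
      c ≤ S.v t x ∧ S.v t x ≤ C := by
  obtain ⟨CE, CE_pos, hE⟩ := energy_bound P
  obtain ⟨Cθ, Cθ_one, hθ⟩ := θ_le_diss P
  obtain ⟨CD, CD_pos, hD⟩ := diss_bound P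
  have hμ := P.μ_pos
  have hR := P.R_pos
  have hT := P.T_pos
  have hε := P.ε_pos
  set B := exp ((CE + 1) / μ) with hB
  have B_pos : 0 < B := exp_pos _
  have B_inv : exp (-((CE + 1) / μ)) = B⁻¹ := exp_neg _
  set L := R / μ * B ^ 2 * CE with hL
  have L_pos : 0 < L := by positivity
  set W := B ^ 2 * exp (L * T) with hW
  have W_pos : 0 < W := by positivity
  set K := R / μ * Cθ * (B * W) with hK
  have K_pos : 0 < K := by positivity
  refine ⟨ε / (B ^ 2 * W), B ^ 3 * (B * (M ^ 2 + 2) + K * (T + CD)), by positivity,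
    by positivity, fun S hS => ?_⟩
  set Y : ℝ → ℝ := fun t => exp (-(S.stressInt t) / μ) with hY
  have Y_pos : ∀ t, 0 < Y t := fun t => exp_pos _
  have Y_zero : Y 0 = 1 := by simp [hY, stressInt]
  set e : ℝ → ℝ → ℝ := fun t x => exp (-(S.pot t x) / μ) with he
  have e_lo : ∀ t ∈ Icc 0 T, ∀ x ∈ Icc (-(1 / 2) : ℝ) (1 / 2), B⁻¹ ≤ e t x := fun t ht x hx => by
    rw [← B_inv]; exact (exp_bounds hμ (abs_pot_le (hE S hS t ht).2 hx)).1
  have e_up : ∀ t ∈ Icc 0 T, ∀ x ∈ Icc (-(1 / 2) : ℝ) (1 / 2), e t x ≤ B := fun t ht x hx =>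
    (exp_bounds hμ (abs_pot_le (hE S hS t ht).2 hx)).2
  have r_eq : ∀ t x, S.renorm t x = S.v t x * (e t x * Y t) := fun t x => rfl
  have r_lo : ∀ t ∈ Icc 0 T, ∀ x ∈ Icc (-(1 / 2) : ℝ) (1 / 2),
      B⁻¹ * Y t * S.v t x ≤ S.renorm t x := fun t ht x hx => by
    rw [r_eq]
    have := mul_le_mul_of_nonneg_right (e_lo t ht x hx)
      (mul_pos (Y_pos t) (S.v_pos t x)).le
    linarith
  have r_up : ∀ t ∈ Icc 0 T, ∀ x ∈ Icc (-(1 / 2) : ℝ) (1 / 2),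
      S.renorm t x ≤ B * Y t * S.v t x := fun t ht x hx => by
    rw [r_eq]
    have := mul_le_mul_of_nonneg_right (e_up t ht x hx)
      (mul_pos (Y_pos t) (S.v_pos t x)).le
    linarith
  have d_up : ∀ t ∈ Icc 0 T, ∀ x ∈ Icc (-(1 / 2) : ℝ) (1 / 2),
      S.renormDeriv t x ≤ R / μ * (B * Y t) * S.θ t x := fun t ht x hx => by
    rw [renormDeriv_eq P ht]
    have := mul_le_mul_of_nonneg_right (e_up t ht x hx)
      (mul_pos (mul_pos (div_pos hR hμ) (Y_pos t)) (S.θ_pos t x)).le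
    linarith
  have d_nonneg : ∀ t ∈ Icc 0 T, ∀ x, 0 ≤ S.renormDeriv t x := fun t ht x => by
    rw [renormDeriv_eq P ht]
    have := S.θ_pos t x
    positivity
  have cr : ∀ t, Continuous (S.renorm t) := fun t =>
    (continuous_renorm S).comp (Continuous.prodMk continuous_const continuous_id)
  have cd : ∀ t, Continuous (S.renormDeriv t) := fun t =>
    (continuous_renormDeriv S).comp (Continuous.prodMk continuous_const continuous_id)
  have cv := S.sp_v.cont
  have H_lo : ∀ t ∈ Icc 0 T, B⁻¹ * Y t ≤ tInt (S.renorm t) := fun t ht => by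
    have h := tInt_mono_on ((cv t).const_mul _) (cr t) (r_lo t ht)
    rwa [tInt_const_mul, tInt_v ht, mul_one] at h
  have H_up : ∀ t ∈ Icc 0 T, tInt (S.renorm t) ≤ B * Y t := fun t ht => by
    have h := tInt_mono_on (cr t) ((cv t).const_mul _) (r_up t ht)
    rwa [tInt_const_mul, tInt_v ht, mul_one] at h
  have zero_mem : (0 : ℝ) ∈ Icc 0 T := ⟨le_rfl, hT.le⟩
  have H_deriv : ∀ t, HasDerivAt (fun t => tInt (S.renorm t)) (tInt (S.renormDeriv t)) t :=
    hasDerivAt_integral_param cr (continuous_renormDeriv S) (hasDerivAt_renorm S) _ _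
  have H_bound := (gronwall_dissipation hT.le (E := fun t => tInt (S.renorm t))
    (D := fun _ => 0) (A := fun _ => L) (B := fun _ => 0) (E₀ := B) (KA := L * T) (KB := 0)
    (fun t _ => H_deriv t) continuous_const continuous_const continuous_const
    (fun t => tInt_nonneg fun x => by
      rw [r_eq]; exact (mul_pos (S.v_pos t x) (mul_pos (exp_pos _) (Y_pos t))).le)
    (fun _ => le_rfl) (fun _ => L_pos.le) (fun _ => le_rfl) (fun t ht => by
      have h1 := tInt_mono_on (cd t) ((S.sp_θ.cont t).const_mul _) (d_up t ht)
      rw [tInt_const_mul] at h1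
      have h2 : R / μ * (B * Y t) * tInt (S.θ t) ≤ R / μ * (B * Y t) * CE :=
        mul_le_mul_of_nonneg_left (hE S hS t ht).1
          (mul_pos (div_pos hR hμ) (mul_pos B_pos (Y_pos t))).le
      have h3 : R / μ * (B * Y t) * CE = L * (B⁻¹ * Y t) := by
        rw [hL]; field_simp
      have h4 := mul_le_mul_of_nonneg_left (H_lo t ht) L_pos.le
      linarith)
    (by simpa [Y_zero] using H_up 0 zero_mem) (by simp [mul_comm]) (by simp)).1
  have Y_up : ∀ t ∈ Icc 0 T, Y t ≤ W := fun t ht => by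
    have h1 := (H_lo t ht).trans (H_bound t ht)
    rw [inv_mul_le_iff₀ B_pos] at h1
    calc Y t ≤ _ := h1
      _ = W := by rw [hW]; ring
  have mono : ∀ t ∈ Icc 0 T, ∀ x, S.renorm 0 x ≤ S.renorm t x := fun t ht x => by
    have := monotone_of_deriv_le (T := T) (fun s _ => (hasDerivAt_renorm S s x).neg)
      (fun s hs => neg_nonpos.2 (d_nonneg s hs x)) ht
    simpa using this
  have Y_lo : ∀ t ∈ Icc 0 T, B⁻¹ ≤ B * Y t := fun t ht => by
    have h1 := H_lo 0 zero_mem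
    rw [Y_zero, mul_one] at h1
    exact h1.trans ((tInt_mono (cr 0) (cr t) (mono t ht)).trans (H_up t ht))
  intro t ht x
  obtain ⟨y, hy, hxy⟩ := exists_mem_period x (S.sp_v.periodic t)
  rw [hxy]
  constructor
  · have h1 := (r_lo 0 zero_mem y hy).trans ((mono t ht y).trans (r_up t ht y hy))
    rw [Y_zero, mul_one] at h1
    have h2 := mul_le_mul_of_nonneg_left (hS.2.1 y) (inv_pos.2 B_pos).le
    have h3 := mul_le_mul_of_nonneg_right (mul_le_mul_of_nonneg_left (Y_up t ht) B_pos.le)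
      (S.v_pos t y).le
    have h4 := h2.trans (h1.trans h3)
    rw [inv_mul_le_iff₀ B_pos] at h4
    rw [div_le_iff₀ (by positivity)]
    linarith
  · have cD : Continuous fun s => 1 + S.diss s := continuous_const.add (continuous_diss S)
    have h1 := monotone_of_deriv_le (T := T) (f := fun t => S.renorm t y
      - K * ∫ s in (0 : ℝ)..t, (1 + S.diss s))
      (fun s _ => (hasDerivAt_renorm S s y).sub ((hasDerivAt_primitive
        cD s).const_mul K)) (fun s hs => by
          have h2 := d_up s hs y hy
          have h3 : R / μ * (B * Y s) * S.θ s y ≤ R / μ * (B * W) * (Cθ * (1 + S.diss s)) :=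
            mul_le_mul (mul_le_mul_of_nonneg_left
              (mul_le_mul_of_nonneg_left (Y_up s hs) B_pos.le) (div_pos hR hμ).le)
              (hθ S hS s hs y) (S.θ_pos s y).le (by positivity)
          rw [hK]
          linarith) ht
    simp only [intervalIntegral.integral_same, mul_zero, sub_zero] at h1
    have h2 : (∫ s in (0 : ℝ)..t, (1 + S.diss s)) ≤ T + CD := by
      refine (primitive_le cD
        (fun s => add_nonneg zero_le_one (diss_nonneg P s)) ht).trans ?_
      rw [intervalIntegral.integral_add (by simp) ((continuous_diss S).intervalIntegrable _ _)]
      simpa using hD S hS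
    have h3 := mul_le_mul_of_nonneg_left h2 K_pos.le
    have h4 := r_up 0 zero_mem y hy
    rw [Y_zero, mul_one] at h4
    have h5 := mul_le_mul_of_nonneg_left (data_v_le P hS y) B_pos.le
    have h6 : B⁻¹ * Y t * S.v t y ≤ B * (M ^ 2 + 2) + K * (T + CD) :=
      (r_lo t ht y hy).trans (by linarith)
    have h7 := mul_le_mul_of_nonneg_left h6 (by positivity : 0 ≤ B ^ 3)
    have h8 : B ^ 3 * (B⁻¹ * Y t * S.v t y) = B * (B * Y t) * S.v t y := by
      field_simp
    have h9 : 1 ≤ B * (B * Y t) := by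
      have := mul_le_mul_of_nonneg_left (Y_lo t ht) B_pos.le
      rwa [mul_inv_cancel₀ B_pos.ne'] at this
    have h10 := mul_le_mul_of_nonneg_right h9 (S.v_pos t y).le
    linarith

end Sol

theorem integral_mul_one_add_le {T K C : ℝ} {g : ℝ → ℝ} (hg : Continuous g) (hK : 0 ≤ K)
    (h : (∫ s in (0 : ℝ)..T, g s) ≤ C) : (∫ s in (0 : ℝ)..T, K * (1 + g s)) ≤ K * (T + C) := by
  rw [intervalIntegral.integral_const_mul,
    intervalIntegral.integral_add (by simp) (hg.intervalIntegrable _ _)]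
  exact mul_le_mul_of_nonneg_left (by simpa using h) hK

namespace Sol

variable {μ R a b κ₁ κ₂ β γ T M ε : ℝ} {S : Sol μ R a b κ₁ κ₂ β γ T} {t : ℝ}

theorem px_θ_sq_le (P : Admissible μ R a b κ₁ κ₂ β γ T M ε) :
    ∃ C, 0 < C ∧ ∀ S : Sol μ R a b κ₁ κ₂ β γ T, S.Bounded M ε → ∀ t ∈ Icc 0 T,
      tInt (fun x => px S.θ t x ^ 2) ≤ C * S.diss t := by
  obtain ⟨c, C, c_pos, C_pos, hv⟩ := v_bounds P
  have hκ₁ := P.κ₁_pos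
  have hκ₂ := P.κ₂_pos
  refine ⟨C / κ₁ + 1 / κ₂, by positivity, fun S hS t ht => ?_⟩
  rw [diss, ← tInt_const_mul]
  refine tInt_mono ((S.sp_θ.px.cont t).pow 2) ((S.sp_dissDensity.cont t).const_mul _) fun x => ?_
  have hθ := S.θ_pos t x
  have hp := rpow_pos_of_pos hθ β
  have v_pos := S.v_pos t x
  have h2 : S.θ t x ^ 2 ≤ 1 + S.θ t x ^ β := by
    rcases le_total (S.θ t x) 1 with h | h
    · nlinarith
    · have := Real.rpow_le_rpow_of_exponent_le h (by linarith [P.four_le_β] : (2 : ℝ) ≤ β)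
      rw [Real.rpow_two] at this
      linarith
  have h3 : 1 ≤ C / κ₁ * (κ₁ / S.v t x) := by
    rw [div_mul_div_comm, mul_comm κ₁, mul_div_mul_right _ _ hκ₁.ne', one_le_div v_pos]
    exact (hv S hS t ht x).2
  have h4 : S.θ t x ^ 2 ≤ (C / κ₁ + 1 / κ₂) * (κ₁ / S.v t x + κ₂ * S.θ t x ^ β) := by
    have e : (C / κ₁ + 1 / κ₂) * (κ₁ / S.v t x + κ₂ * S.θ t x ^ β)
        = C / κ₁ * (κ₁ / S.v t x) + S.θ t x ^ β
          + (C / κ₁ * (κ₂ * S.θ t x ^ β) + 1 / κ₂ * (κ₁ / S.v t x)) := by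
      field_simp
      ring
    have : 0 ≤ C / κ₁ * (κ₂ * S.θ t x ^ β) + 1 / κ₂ * (κ₁ / S.v t x) := by positivity
    rw [e]
    linarith
  have h5 := mul_le_mul_of_nonneg_right h4
    (by positivity : 0 ≤ px S.θ t x ^ 2 / S.θ t x ^ 2)
  have h6 : S.θ t x ^ 2 * (px S.θ t x ^ 2 / S.θ t x ^ 2) = px S.θ t x ^ 2 := by field_simp
  rw [dissDensity_eq, ← mul_assoc]
  linarith

variable (S) in
/-- The effective velocity `u - μ v_x / v`. -/
def effVel (t x : ℝ) : ℝ := S.u t x - μ * (px S.v t x / S.v t x)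

theorem sp_effVel (S : Sol μ R a b κ₁ κ₂ β γ T) : SmoothPeriodic S.effVel :=
  S.sp_u.sub ((SmoothPeriodic.const μ).mul (S.sp_v.px.div S.sp_v S.v_pos))

theorem pt_effVel (ht : t ∈ Icc 0 T) (x : ℝ) :
    pt S.effVel t x = -px (fun s y => R * S.θ s y / S.v s y) t x := by
  have hl : SmoothPeriodic fun s y => Real.log (S.v s y) := S.sp_v.log S.v_pos
  have hw : SmoothPeriodic fun s y => px S.u s y / S.v s y := S.sp_u.px.div S.sp_v S.v_pos
  have e1 : px (fun s y => Real.log (S.v s y)) = fun s y => px S.v s y / S.v s y := by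
    funext s y
    exact px_eq_of_hasDerivAt ((S.sp_v.hasDerivAt_px s y).log (S.v_pos s y).ne')
  have e2 : pt (fun s y => Real.log (S.v s y)) t = fun y => px S.u t y / S.v t y := by
    funext y
    rw [← pt_v ht]
    exact pt_eq_of_hasDerivAt (f := fun s y => Real.log (S.v s y))
      ((S.sp_v.hasDerivAt_pt t y).log (S.v_pos t y).ne')
  have e3 : pt (fun s y => px S.v s y / S.v s y) t x
      = px (fun s y => px S.u s y / S.v s y) t x := by
    rw [← e1, hl.comm]
    simp only [px, e2]
  have e4 : px S.stress t x = μ * px (fun s y => px S.u s y / S.v s y) t x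
      - px (fun s y => R * S.θ s y / S.v s y) t x := by
    refine px_eq_of_hasDerivAt (HasDerivAt.sub ?_ (S.sp_pressure.hasDerivAt_px t x))
    simpa only [mul_div_assoc] using (hw.hasDerivAt_px t x).const_mul μ
  rw [pt_eq_of_hasDerivAt (f := S.effVel) ((S.sp_u.hasDerivAt_pt t x).sub
    (((S.sp_v.px.div S.sp_v S.v_pos).hasDerivAt_pt t x).const_mul μ)), e3, pt_u ht, e4]
  ring

theorem effVel_bound (P : Admissible μ R a b κ₁ κ₂ β γ T M ε) :
    ∃ C, 0 < C ∧ ∀ S : Sol μ R a b κ₁ κ₂ β γ T, S.Bounded M ε → ∀ t ∈ Icc 0 T,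
      tInt (fun x => S.effVel t x ^ 2) ≤ C := by
  obtain ⟨c, C, c_pos, C_pos, hv⟩ := v_bounds P
  obtain ⟨CE, CE_pos, hE⟩ := energy_bound P
  obtain ⟨Cθ, Cθ_one, hθ⟩ := θ_le_diss P
  obtain ⟨CD, CD_pos, hD⟩ := diss_bound P
  obtain ⟨Cx, Cx_pos, hx⟩ := px_θ_sq_le P
  have hμ := P.μ_pos
  have hR := P.R_pos
  have hT := P.T_pos
  have hε := P.ε_pos
  have hM : 0 < M := zero_lt_one.trans_le P.one_le_M
  set K := R ^ 2 / c ^ 2 * Cx + R * Cθ / (2 * c * μ) * CE with hK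
  have K_pos : 0 < K := by positivity
  refine ⟨(2 * M ^ 2 + 2 * μ ^ 2 / ε ^ 2 * M ^ 2 + K * (T + CD)) * exp T, by positivity,
    fun S hS => ?_⟩
  have hw := S.sp_effVel
  refine (gronwall_dissipation hT.le (E := fun t => tInt (fun x => S.effVel t x ^ 2))
    (D := fun _ => 0) (A := fun _ => 1) (B := fun t => K * (1 + S.diss t))
    (fun t _ => (hw.pow 2).hasDerivAt_tInt t) continuous_const continuous_const
    (continuous_const.mul (continuous_const.add (continuous_diss S)))
    (fun t => tInt_nonneg fun x => sq_nonneg _) (fun _ => le_rfl) (fun _ => zero_le_one)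
    (fun t => mul_nonneg K_pos.le (add_nonneg zero_le_one (diss_nonneg P t)))
    (fun t ht => ?_) ?_ (by simp) (integral_mul_one_add_le (continuous_diss S) K_pos.le
      (hD S hS))).1
  · have D_nonneg := diss_nonneg (S := S) P t
    have key := tInt_le_combination (c₁ := 1) (c₂ := R ^ 2 / c ^ 2)
      (c₃ := R * (Cθ * (1 + S.diss t)) / (2 * c * μ)) (c₄ := 0)
      ((hw.pow 2).pt.cont t) ((hw.pow 2).cont t) ((S.sp_θ.px.pow 2).cont t)
      ((S.sp_u.pow 2).cont t) (fun x => by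
        have v_pos := S.v_pos t x
        have θ_pos := S.θ_pos t x
        have hvc := (hv S hS t ht x).1
        rw [pt_eq_of_hasDerivAt (f := fun s y => S.effVel s y ^ 2)
          ((hw.hasDerivAt_pt t x).fun_pow 2), pt_effVel ht, px_pressure]
        set w := S.effVel t x with hw
        have e : px S.v t x = S.v t x * ((S.u t x - w) / μ) := by
          rw [hw, effVel]; field_simp; ring
        rw [e]
        have e2 : (2 : ℕ) * w ^ (2 - 1) * -(R * px S.θ t x / S.v t x
              - R * S.θ t x * (S.v t x * ((S.u t x - w) / μ)) / S.v t x ^ 2)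
            = -(2 * w * (R * px S.θ t x / S.v t x))
              + 2 * R * S.θ t x / (μ * S.v t x) * (w * (S.u t x - w)) := by
          field_simp
          ring
        have i1 : -(2 * w * (R * px S.θ t x / S.v t x))
            ≤ w ^ 2 + (R * px S.θ t x / S.v t x) ^ 2 := by
          nlinarith [sq_nonneg (w + R * px S.θ t x / S.v t x)]
        have i2 : (R * px S.θ t x / S.v t x) ^ 2 ≤ R ^ 2 / c ^ 2 * px S.θ t x ^ 2 := by
          rw [div_pow, mul_pow, div_mul_eq_mul_div]
          gcongr
        have i3 : 2 * R * S.θ t x / (μ * S.v t x) * (w * (S.u t x - w))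
            ≤ 2 * R * S.θ t x / (μ * S.v t x) * (S.u t x ^ 2 / 4) :=
          mul_le_mul_of_nonneg_left (by nlinarith [sq_nonneg (S.u t x - 2 * w)])
            (by positivity)
        have i4 : 2 * R * S.θ t x / (μ * S.v t x) * (S.u t x ^ 2 / 4)
            ≤ 2 * R * (Cθ * (1 + S.diss t)) / (μ * c) * (S.u t x ^ 2 / 4) := by
          have := hθ S hS t ht x
          gcongr
        have e3 : 2 * R * (Cθ * (1 + S.diss t)) / (μ * c) * (S.u t x ^ 2 / 4)
            = R * (Cθ * (1 + S.diss t)) / (2 * c * μ) * S.u t x ^ 2 := by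
          field_simp
          ring
        rw [e2]
        linarith)
    have k1 := mul_le_mul_of_nonneg_left (hx S hS t ht) (by positivity : 0 ≤ R ^ 2 / c ^ 2)
    have k2 := mul_le_mul_of_nonneg_left (hE S hS t ht).2
      (by positivity : 0 ≤ R * (Cθ * (1 + S.diss t)) / (2 * c * μ))
    have e : K * (1 + S.diss t) = R ^ 2 / c ^ 2 * (Cx * S.diss t)
        + R * (Cθ * (1 + S.diss t)) / (2 * c * μ) * CE + R ^ 2 / c ^ 2 * Cx := by
      rw [hK]; field_simp; ring
    have : 0 ≤ R ^ 2 / c ^ 2 * Cx := by positivity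
    rw [e]
    linarith
  · obtain ⟨d1, d2, -⟩ := hS.data_le P.one_le_M
    have key := tInt_le_combination (c₁ := 2) (c₂ := 2 * μ ^ 2 / ε ^ 2) (c₃ := 0) (c₄ := 0)
      ((hw.pow 2).cont 0) ((S.sp_u.pow 2).cont 0) ((S.sp_v.px.pow 2).cont 0)
      ((S.sp_u.pow 2).cont 0) (fun x => by
        have i : (μ * (px S.v 0 x / S.v 0 x)) ^ 2 ≤ μ ^ 2 / ε ^ 2 * px S.v 0 x ^ 2 := by
          rw [mul_pow, div_pow, div_mul_eq_mul_div, mul_div_assoc]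
          have := hS.2.1 x
          gcongr
        have j : 2 * μ ^ 2 / ε ^ 2 * px S.v 0 x ^ 2 = 2 * (μ ^ 2 / ε ^ 2 * px S.v 0 x ^ 2) := by
          ring
        rw [j, effVel]
        nlinarith [sq_nonneg (S.u 0 x + μ * (px S.v 0 x / S.v 0 x))])
    have k1 := mul_le_mul_of_nonneg_left d1 (by positivity : 0 ≤ 2 * μ ^ 2 / ε ^ 2)
    linarith

theorem px_v_bound (P : Admissible μ R a b κ₁ κ₂ β γ T M ε) :
    ∃ C, 0 < C ∧ ∀ S : Sol μ R a b κ₁ κ₂ β γ T, S.Bounded M ε → ∀ t ∈ Icc 0 T,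
      tInt (fun x => px S.v t x ^ 2) ≤ C := by
  obtain ⟨c, C, c_pos, C_pos, hv⟩ := v_bounds P
  obtain ⟨CE, CE_pos, hE⟩ := energy_bound P
  obtain ⟨Cw, Cw_pos, hw⟩ := effVel_bound P
  have hμ := P.μ_pos
  refine ⟨2 * C ^ 2 / μ ^ 2 * (CE + Cw), by positivity, fun S hS t ht => ?_⟩
  have key := tInt_le_combination (c₁ := 2 * C ^ 2 / μ ^ 2) (c₂ := 2 * C ^ 2 / μ ^ 2) (c₃ := 0)
    (c₄ := 0) ((S.sp_v.px.pow 2).cont t) ((S.sp_u.pow 2).cont t) ((S.sp_effVel.pow 2).cont t)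
    ((S.sp_u.pow 2).cont t) (fun x => by
      have v_pos := S.v_pos t x
      have hvC := (hv S hS t ht x).2
      have e : px S.v t x = S.v t x * (S.u t x - S.effVel t x) / μ := by
        rw [effVel]; field_simp; ring
      have i : px S.v t x ^ 2 ≤ C ^ 2 / μ ^ 2 * (S.u t x - S.effVel t x) ^ 2 := by
        rw [e, div_pow, mul_pow, div_mul_eq_mul_div]
        gcongr
      have j := mul_le_mul_of_nonneg_left (by nlinarith [sq_nonneg (S.u t x + S.effVel t x)] :
        (S.u t x - S.effVel t x) ^ 2 ≤ 2 * (S.u t x ^ 2 + S.effVel t x ^ 2))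
        (by positivity : 0 ≤ C ^ 2 / μ ^ 2)
      have k : C ^ 2 / μ ^ 2 * (2 * (S.u t x ^ 2 + S.effVel t x ^ 2))
        = 2 * C ^ 2 / μ ^ 2 * S.u t x ^ 2 + 2 * C ^ 2 / μ ^ 2 * S.effVel t x ^ 2 := by ring
      linarith)
  have := mul_le_mul_of_nonneg_left (add_le_add (hE S hS t ht).2 (hw S hS t ht))
    (by positivity : 0 ≤ 2 * C ^ 2 / μ ^ 2)
  linarith

variable (S) in
/-- The dissipation `∫ u_xx²` of the velocity gradient. -/
def visc (t : ℝ) : ℝ := tInt fun x => px (px S.u) t x ^ 2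

theorem visc_nonneg (S : Sol μ R a b κ₁ κ₂ β γ T) (t : ℝ) : 0 ≤ S.visc t :=
  tInt_nonneg fun _ => sq_nonneg _

theorem continuous_visc (S : Sol μ R a b κ₁ κ₂ β γ T) : Continuous S.visc :=
  (S.sp_u.px.px.pow 2).continuous_tInt

theorem tInt_pt_px_u_sq (ht : t ∈ Icc 0 T) :
    tInt (pt (fun s y => px S.u s y ^ 2) t)
      = tInt (fun x => -2 * px (px S.u) t x * px S.stress t x) := by
  have hg : SmoothPeriodic fun s y => 2 * px S.u s y * px S.stress s y :=
    ((SmoothPeriodic.const 2).mul S.sp_u.px).mul S.sp_stress.px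
  have cJ : Continuous fun x => -2 * px (px S.u) t x * px S.stress t x :=
    (continuous_const.mul (S.sp_u.px.px.cont t)).mul (S.sp_stress.px.cont t)
  have e : pt (fun s y => px S.u s y ^ 2) t
      = fun x => px (fun s y => 2 * px S.u s y * px S.stress s y) t x
        + -2 * px (px S.u) t x * px S.stress t x := by
    funext x
    have e1 : pt (px S.u) t x = px (px S.stress) t x := by
      rw [S.sp_u.comm, px, px, funext fun y => pt_u (S := S) ht y]
    rw [pt_eq_of_hasDerivAt (f := fun s y => px S.u s y ^ 2)
      ((S.sp_u.px.hasDerivAt_pt t x).fun_pow 2), e1,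
      px_eq_of_hasDerivAt (f := fun s y => 2 * px S.u s y * px S.stress s y)
        (((S.sp_u.px.hasDerivAt_px t x).const_mul 2).mul
        (S.sp_stress.px.hasDerivAt_px t x))]
    push_cast
    ring
  rw [e, tInt_add (hg.px.cont t) cJ, hg.tInt_px, zero_add]

/-- Energy estimate for the velocity gradient. -/
theorem px_u_bound (P : Admissible μ R a b κ₁ κ₂ β γ T M ε) :
    ∃ C, 0 < C ∧ ∀ S : Sol μ R a b κ₁ κ₂ β γ T, S.Bounded M ε →
      (∀ t ∈ Icc 0 T, tInt (fun x => px S.u t x ^ 2) ≤ C) ∧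
        (∫ s in (0 : ℝ)..T, S.visc s) ≤ C := by
  obtain ⟨c, C, c_pos, C_pos, hv⟩ := v_bounds P
  obtain ⟨Cθ, Cθ_one, hθ⟩ := θ_sq_le_diss P
  obtain ⟨CD, CD_pos, hD⟩ := diss_bound P
  obtain ⟨Cx, Cx_pos, hx⟩ := px_θ_sq_le P
  obtain ⟨N, N_pos, hN⟩ := px_v_bound P
  have hμ := P.μ_pos
  have hR := P.R_pos
  have hT := P.T_pos
  have hM : 0 < M := zero_lt_one.trans_le P.one_le_M
  set m := μ / C with hm
  have m_pos : 0 < m := by positivity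
  set L := 3 / m * (μ ^ 2 / c ^ 4) * N with hL
  have L_pos : 0 < L := by positivity
  set δ := m / (2 * L) with hδ
  have δ_pos : 0 < δ := by positivity
  set K := 3 / m * (R ^ 2 / c ^ 4 * Cθ * N + R ^ 2 / c ^ 2 * Cx) with hK
  have K_pos : 0 < K := by positivity
  set A := L * (1 + 1 / δ) with hA
  have A_pos : 0 < A := by positivity
  set Q := (M ^ 2 + K * (T + CD)) * exp (A * T) with hQ
  have Q_pos : 0 < Q := by positivity
  refine ⟨Q + 2 / m * Q, by positivity, fun S hS => ?_⟩
  have main := gronwall_dissipation hT.le (E := fun t => tInt (fun x => px S.u t x ^ 2))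
    (D := fun t => m / 2 * S.visc t) (A := fun _ => A) (B := fun t => K * (1 + S.diss t))
    (E₀ := M ^ 2) (KA := A * T) (KB := K * (T + CD))
    (fun t _ => (S.sp_u.px.pow 2).hasDerivAt_tInt t) (continuous_const.mul (continuous_visc S))
    continuous_const
    (continuous_const.mul (continuous_const.add (continuous_diss S)))
    (fun t => tInt_nonneg fun x => sq_nonneg _)
    (fun t => mul_nonneg (by positivity) (visc_nonneg S t)) (fun _ => A_pos.le)
    (fun t => mul_nonneg K_pos.le (add_nonneg zero_le_one (diss_nonneg P t)))
    (fun t ht => by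
      have D_nonneg := diss_nonneg (S := S) P t
      have V_nonneg := visc_nonneg S t
      rw [tInt_pt_px_u_sq ht]
      have cJ : Continuous fun x => -2 * px (px S.u) t x * px S.stress t x :=
        (continuous_const.mul (S.sp_u.px.px.cont t)).mul (S.sp_stress.px.cont t)
      set X := (1 + 1 / δ) * tInt (fun y => px S.u t y ^ 2) + δ * S.visc t with hX
      have X_nonneg : 0 ≤ X := (sq_nonneg _).trans (S.sp_u.px.sq_le δ_pos t 0)
      set Θ := Cθ * (1 + S.diss t) with hΘ
      have key := tInt_le_combination (c₁ := -m)
        (c₂ := 3 / m * (μ ^ 2 / c ^ 4 * X + R ^ 2 / c ^ 4 * Θ))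
        (c₃ := 3 / m * (R ^ 2 / c ^ 2)) (c₄ := 0)
        cJ ((S.sp_u.px.px.pow 2).cont t) ((S.sp_v.px.pow 2).cont t)
        ((S.sp_θ.px.pow 2).cont t) (fun x => by
          have v_pos := S.v_pos t x
          obtain ⟨hvc, hvC⟩ := hv S hS t ht x
          have hux : px S.u t x ^ 2 ≤ X := S.sp_u.px.sq_le δ_pos t x
          have hθx : S.θ t x ^ 2 ≤ Θ := hθ S hS t ht x
          rw [px_stress]
          set p := px (px S.u) t x
          set y₁ := μ * px S.u t x * px S.v t x / S.v t x ^ 2 with hy₁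
          set y₂ := R * px S.θ t x / S.v t x with hy₂
          set y₃ := R * S.θ t x * px S.v t x / S.v t x ^ 2 with hy₃
          have i1 : y₁ ^ 2 ≤ μ ^ 2 / c ^ 4 * X * px S.v t x ^ 2 := by
            have e : y₁ ^ 2 = μ ^ 2 / S.v t x ^ 4 * px S.u t x ^ 2 * px S.v t x ^ 2 := by
              rw [hy₁]; field_simp
            rw [e]
            gcongr
          have i2 : y₂ ^ 2 ≤ R ^ 2 / c ^ 2 * px S.θ t x ^ 2 := by
            have e : y₂ ^ 2 = R ^ 2 / S.v t x ^ 2 * px S.θ t x ^ 2 := by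
              rw [hy₂]; field_simp
            rw [e]
            gcongr
          have i3 : y₃ ^ 2 ≤ R ^ 2 / c ^ 4 * Θ * px S.v t x ^ 2 := by
            have e : y₃ ^ 2 = R ^ 2 / S.v t x ^ 4 * S.θ t x ^ 2 * px S.v t x ^ 2 := by
              rw [hy₃]; field_simp
            rw [e]
            gcongr
          have i4 : m * p ^ 2 ≤ μ * p / S.v t x * p := by
            have : m ≤ μ / S.v t x := div_le_div_of_nonneg_left hμ.le v_pos hvC
            have := mul_le_mul_of_nonneg_right this (sq_nonneg p)
            calc _ ≤ _ := this
              _ = _ := by ring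
          have i5 : 2 * p * (y₁ + y₂ - y₃) ≤ m * p ^ 2 + 3 / m * (y₁ ^ 2 + y₂ ^ 2 + y₃ ^ 2) := by
            have e : m * p ^ 2 + 3 / m * (y₁ ^ 2 + y₂ ^ 2 + y₃ ^ 2) - 2 * p * (y₁ + y₂ - y₃)
                = ((m * p - (y₁ + y₂ - y₃)) ^ 2
                  + ((y₁ - y₂) ^ 2 + (y₁ + y₃) ^ 2 + (y₂ + y₃) ^ 2)) / m := by
              field_simp; ring
            have : 0 ≤ ((m * p - (y₁ + y₂ - y₃)) ^ 2
                + ((y₁ - y₂) ^ 2 + (y₁ + y₃) ^ 2 + (y₂ + y₃) ^ 2)) / m := by positivity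
            linarith
          have i6 := mul_le_mul_of_nonneg_left (add_le_add (add_le_add i1 i2) i3)
            (by positivity : 0 ≤ 3 / m)
          linarith)
      have k1 := mul_le_mul_of_nonneg_left (hN S hS t ht)
        (by positivity : 0 ≤ 3 / m * (μ ^ 2 / c ^ 4 * X + R ^ 2 / c ^ 4 * Θ))
      have k2 := mul_le_mul_of_nonneg_left (hx S hS t ht)
        (by positivity : 0 ≤ 3 / m * (R ^ 2 / c ^ 2))
      have e1 : 3 / m * (μ ^ 2 / c ^ 4 * X + R ^ 2 / c ^ 4 * Θ) * N
          = A * tInt (fun y => px S.u t y ^ 2) + m / 2 * S.visc t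
            + 3 / m * (R ^ 2 / c ^ 4 * Cθ * N) * (1 + S.diss t) := by
        have : L * δ = m / 2 := by rw [hδ]; field_simp
        rw [hΘ, hA, ← this, hX, hL]
        ring
      have e2 : K * (1 + S.diss t) = 3 / m * (R ^ 2 / c ^ 4 * Cθ * N) * (1 + S.diss t)
          + 3 / m * (R ^ 2 / c ^ 2) * (Cx * S.diss t) + 3 / m * (R ^ 2 / c ^ 2) * Cx := by
        rw [hK]; ring
      have p : 0 ≤ 3 / m * (R ^ 2 / c ^ 2) * Cx := by positivity
      have eV : tInt (fun x => px (px S.u) t x ^ 2) = S.visc t := rfl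
      rw [eV] at key
      rw [e2]
      linarith)
    (hS.data_le P.one_le_M).2.2.1 (by simp [mul_comm])
    (integral_mul_one_add_le (continuous_diss S) K_pos.le (hD S hS))
  obtain ⟨m1, m2⟩ := main
  refine ⟨fun t ht => (m1 t ht).trans
    (le_add_of_nonneg_right (by positivity)), ?_⟩
  rw [intervalIntegral.integral_const_mul] at m2
  have := mul_le_mul_of_nonneg_left m2 (by positivity : 0 ≤ 2 / m)
  have e : 2 / m * (m / 2 * ∫ s in (0 : ℝ)..T, S.visc s) = ∫ s in (0 : ℝ)..T, S.visc s := by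
    field_simp
  linarith

theorem px_u_sq_le (P : Admissible μ R a b κ₁ κ₂ β γ T M ε) :
    ∃ C, 0 < C ∧ ∀ S : Sol μ R a b κ₁ κ₂ β γ T, S.Bounded M ε → ∀ t ∈ Icc 0 T, ∀ x,
      px S.u t x ^ 2 ≤ C * (1 + S.visc t) := by
  obtain ⟨C, C_pos, h⟩ := px_u_bound P
  refine ⟨2 * C + 1, by positivity, fun S hS t ht x => ?_⟩
  have h1 := S.sp_u.px.sq_le one_pos t x
  have h2 := (h S hS).1 t ht
  have h3 := mul_nonneg C_pos.le (visc_nonneg S t)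
  have h4 : tInt (fun y => px (px S.u) t y ^ 2) = S.visc t := rfl
  rw [h4] at h1
  linarith

end Sol

/-- A comparison principle: a space-periodic function whose time derivative is negative at every
spatial maximum is bounded by its initial values. -/
theorem exists_le_of_deriv_neg {T : ℝ} {g g' : ℝ → ℝ → ℝ}
    (hg : Continuous fun p : ℝ × ℝ => g p.1 p.2) (hp : ∀ t, Function.Periodic (g t) 1)
    (hd : ∀ t x, HasDerivAt (fun s => g s x) (g' t x) t)
    (hneg : ∀ t ∈ Icc 0 T, ∀ y, (∀ x, g t x ≤ g t y) → g' t y < 0) {t : ℝ} (ht : t ∈ Icc 0 T)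
    (x : ℝ) : ∃ y, g t x ≤ g 0 y := by
  obtain ⟨⟨s, y⟩, hsy, hm⟩ := (isCompact_Icc.prod isCompact_Icc).exists_isMaxOn
    (s := Icc 0 T ×ˢ Icc (-(1 / 2) : ℝ) (1 / 2)) ⟨(t, 0), ht, by norm_num, by norm_num⟩
    hg.continuousOn
  have le_max : ∀ r ∈ Icc 0 T, ∀ z, g r z ≤ g s y := fun r hr z => by
    obtain ⟨z', hz', e⟩ := exists_mem_period z (hp r)
    rw [e]
    exact hm (show (r, z') ∈ _ from ⟨hr, hz'⟩)
  rcases hsy.1.1.eq_or_lt with h0 | h0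
  · refine ⟨y, ?_⟩
    have := le_max t ht x
    rwa [← show (0 : ℝ) = s from h0] at this
  · exfalso
    have h1 := hneg s hsy.1 y fun z => le_max s hsy.1 z
    have h2 := (hasDerivAt_iff_tendsto_slope.1 (hd s y)).mono_left
      (nhdsWithin_mono s (show Iio s ⊆ {s}ᶜ from fun _ hr => ne_of_lt hr))
    obtain ⟨r, hr, hr0, hrs⟩ := ((h2.eventually_lt_const h1).and (Ioo_mem_nhdsLT h0)).exists
    have h3 := le_max r ⟨hr0.le, hrs.le.trans hsy.1.2⟩ y
    rw [slope_def_field] at hr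
    have := div_nonneg_of_nonpos (sub_nonpos.2 h3) (sub_nonpos.2 hrs.le)
    linarith

namespace Sol

variable {μ R a b κ₁ κ₂ β γ T M ε : ℝ} {S : Sol μ R a b κ₁ κ₂ β γ T} {t : ℝ}

theorem px_flux_nonpos_of_isMax (P : Admissible μ R a b κ₁ κ₂ β γ T M ε) {y : ℝ}
    (hy : ∀ x, S.θ t x ≤ S.θ t y) : px S.flux t y ≤ 0 := by
  have hmin : IsLocalMin (fun x => -S.θ t x) y := Eventually.of_forall fun x => neg_le_neg (hy x)
  have hd : ∀ x, HasDerivAt (fun x => -S.θ t x) (-px S.θ t x) x :=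
    fun x => (S.sp_θ.hasDerivAt_px t x).neg
  have h0 : px S.θ t y = 0 := by
    rw [← neg_eq_zero, ← (hd y).deriv]; exact hmin.deriv_eq_zero
  have h2 := deriv_deriv_nonneg_of_isLocalMin hmin (S.sp_θ.cont t).neg.continuousAt
    (by rw [funext fun z => (hd z).deriv]; exact (S.sp_θ.px.hasDerivAt_px t y).neg)
  have hv := S.v_pos t y
  rw [px_eq_of_hasDerivAt (f := S.flux) (((S.sp_kappa.hasDerivAt_px t y).mul
    (S.sp_θ.px.hasDerivAt_px t y)).div (S.sp_v.hasDerivAt_px t y) hv.ne'), Pi.mul_apply, h0]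
  simp only [mul_zero, zero_add, zero_mul, sub_zero]
  have := kappa_pos (S := S) P t y
  refine div_nonpos_of_nonpos_of_nonneg (mul_nonpos_of_nonpos_of_nonneg
    (mul_nonpos_of_nonneg_of_nonpos this.le (by linarith)) hv.le) (by positivity)

theorem px_q_nonneg_of_isMax (P : Admissible μ R a b κ₁ κ₂ β γ T M ε) (ht : t ∈ Icc 0 T) {y : ℝ}
    (hy : ∀ x, S.θ t x ≤ S.θ t y) : 0 ≤ px S.q t y := by
  obtain ⟨z, hz⟩ := exists_rad_le (S := S) P ht
  rw [px_q]
  refine mul_nonneg (S.v_pos t y).le (sub_nonneg.2 ((hz y).trans ?_))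
  exact mul_le_mul_of_nonneg_left (pow_le_pow_left₀ (S.θ_pos t z).le (hy z) 4) P.b_pos.le

/-- Uniform upper bound for the temperature. -/
theorem θ_bound (P : Admissible μ R a b κ₁ κ₂ β γ T M ε) :
    ∃ C, 1 ≤ C ∧ ∀ S : Sol μ R a b κ₁ κ₂ β γ T, S.Bounded M ε → ∀ t ∈ Icc 0 T, ∀ x,
      S.θ t x ≤ C := by
  obtain ⟨c, C, c_pos, C_pos, hv⟩ := v_bounds P
  obtain ⟨Cu, Cu_pos, hu⟩ := px_u_sq_le P
  obtain ⟨CU, CU_pos, hU⟩ := px_u_bound P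
  have hμ := P.μ_pos
  have hR := P.R_pos
  have hT := P.T_pos
  set cv := R / (γ - 1) with hcv
  have cv_pos : 0 < cv := P.cv_pos
  set K := (μ / c * Cu + R / c * (1 + Cu)) / cv with hK
  have K_pos : 0 < K := by positivity
  have E_pos : 0 ≤ K * (T + CU) := by positivity
  refine ⟨(T + (3 * M ^ 2 + 2)) * exp (K * (T + CU)), ?_, fun S hS t ht x => ?_⟩
  · exact one_le_mul_of_one_le_of_one_le (by nlinarith) (one_le_exp E_pos)
  have cA : Continuous fun t => K * (1 + S.visc t) :=
    continuous_const.mul (continuous_const.add (continuous_visc S))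
  have A_nonneg : ∀ t, 0 ≤ K * (1 + S.visc t) := fun t =>
    mul_nonneg K_pos.le (add_nonneg zero_le_one (visc_nonneg S t))
  set α : ℝ → ℝ := fun t => ∫ s in (0 : ℝ)..t, K * (1 + S.visc s) with hα
  have dα : ∀ t, HasDerivAt α (K * (1 + S.visc t)) t := hasDerivAt_primitive cA
  have cα : Continuous α := continuous_iff_continuousAt.2 fun t => (dα t).continuousAt
  have cθ := S.sp_θ.joint
  obtain ⟨y, hy⟩ := exists_le_of_deriv_neg (T := T)
    (g := fun t x => exp (-α t) * (S.θ t x + 1) - t)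
    (by fun_prop) (fun t x => by simp only [S.sp_θ.periodic t x])
    (fun t x => ((dα t).neg.exp.mul ((S.sp_θ.hasDerivAt_pt t x).add_const 1)).sub (hasDerivAt_id t))
    (fun t ht y hy => by
      have hmax : ∀ x, S.θ t x ≤ S.θ t y := fun x => by
        have := hy x
        simp only [sub_le_sub_iff_right] at this
        linarith [le_of_mul_le_mul_left this (exp_pos _)]
      have v_pos := S.v_pos t y
      have θ_pos := S.θ_pos t y
      have U_nonneg := visc_nonneg S t
      have hvc := (hv S hS t ht y).1
      have hux := hu S hS t ht y
      have i1 : μ * px S.u t y ^ 2 / S.v t y ≤ μ / c * Cu * (1 + S.visc t) := by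
        have : μ * px S.u t y ^ 2 / S.v t y ≤ μ * (Cu * (1 + S.visc t)) / c := by gcongr
        calc _ ≤ _ := this
          _ = _ := by ring
      have i2 : -px S.u t y ≤ (1 + Cu) * (1 + S.visc t) := by
        nlinarith [sq_nonneg (px S.u t y + 1), mul_nonneg Cu_pos.le U_nonneg]
      have i3 : -(R * S.θ t y * px S.u t y / S.v t y)
          ≤ R / c * (1 + Cu) * (1 + S.visc t) * S.θ t y := by
        have h1 : R * S.θ t y / S.v t y * -px S.u t y
            ≤ R * S.θ t y / S.v t y * ((1 + Cu) * (1 + S.visc t)) :=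
          mul_le_mul_of_nonneg_left i2 (by positivity)
        have h2 : R * S.θ t y / S.v t y * ((1 + Cu) * (1 + S.visc t))
            ≤ R * S.θ t y / c * ((1 + Cu) * (1 + S.visc t)) := by gcongr
        calc -(R * S.θ t y * px S.u t y / S.v t y) = _ := by ring
          _ ≤ _ := h1.trans h2
          _ = _ := by ring
      have e := temperature_eq (S := S) ht y
      have i4 : cv * pt S.θ t y ≤ cv * (K * (1 + S.visc t) * (S.θ t y + 1)) := by
        have h1 := px_flux_nonpos_of_isMax P hmax
        have h2 := px_q_nonneg_of_isMax P ht hmax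
        have e2 : cv * (K * (1 + S.visc t) * (S.θ t y + 1))
            = μ / c * Cu * (1 + S.visc t) + R / c * (1 + Cu) * (1 + S.visc t) * S.θ t y
              + (μ / c * Cu * (1 + S.visc t) * S.θ t y + R / c * (1 + Cu) * (1 + S.visc t)) := by
          rw [hK]; field_simp; ring
        have : 0 ≤ μ / c * Cu * (1 + S.visc t) * S.θ t y + R / c * (1 + Cu) * (1 + S.visc t) := by
          positivity
        rw [e2]
        linarith
      have i5 := mul_le_mul_of_nonneg_left (le_of_mul_le_mul_left i4 cv_pos) (exp_pos (-α t)).le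
      simp only [Pi.neg_apply]
      linarith) ht x
  have α_zero : α 0 = 0 := by simp [hα]
  simp only [α_zero, neg_zero, exp_zero, one_mul, sub_zero] at hy
  have h0 : S.θ 0 y ≤ 3 * M ^ 2 + 1 := by
    have h1 := S.sp_θ.sq_le one_pos 0 y
    have d := (hS.data_le P.one_le_M).2.2.2
    nlinarith [sq_nonneg (S.θ 0 y - 1), d.1, d.2]
  have hαt : α t ≤ K * (T + CU) := (primitive_le cA A_nonneg ht).trans
    (integral_mul_one_add_le (continuous_visc S) K_pos.le (hU S hS).2)
  have h1 : exp (-α t) * (S.θ t x + 1) ≤ T + (3 * M ^ 2 + 2) := by linarith [ht.2]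
  have h2 := mul_le_mul h1 (exp_le_exp.2 hαt) (exp_pos _).le (by positivity)
  have h3 : exp (-α t) * (S.θ t x + 1) * exp (α t) = S.θ t x + 1 := by
    rw [mul_right_comm, ← exp_add]; simp
  linarith

theorem px_q_bound (P : Admissible μ R a b κ₁ κ₂ β γ T M ε) :
    ∃ C, 0 < C ∧ ∀ S : Sol μ R a b κ₁ κ₂ β γ T, S.Bounded M ε → ∀ t ∈ Icc 0 T, ∀ x,
      |px S.q t x| ≤ C := by
  obtain ⟨c, C, c_pos, C_pos, hv⟩ := v_bounds P
  obtain ⟨Cθ, Cθ_one, hθ⟩ := θ_bound P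
  have hb := P.b_pos
  have Cθ_pos : 0 < Cθ := zero_lt_one.trans_le Cθ_one
  refine ⟨C * (b * Cθ ^ 4), by positivity, fun S hS t ht x => ?_⟩
  have hle : ∀ y, b * S.θ t y ^ 4 ≤ b * Cθ ^ 4 := fun y =>
    mul_le_mul_of_nonneg_left (pow_le_pow_left₀ (S.θ_pos t y).le (hθ S hS t ht y) 4) hb.le
  obtain ⟨z, hz⟩ := exists_rad_le (S := S) P ht
  have h1 := rad_pos (S := S) P ht x
  have h2 := (hz x).trans (hle z)
  have h3 : 0 < b * S.θ t x ^ 4 := mul_pos hb (pow_pos (S.θ_pos t x) 4)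
  rw [px_q, abs_mul, abs_of_pos (S.v_pos t x)]
  refine mul_le_mul (hv S hS t ht x).2 (abs_le.2 ⟨?_, ?_⟩) (abs_nonneg _) C_pos.le
  · linarith
  · linarith [hle x]

theorem exists_q_eq_zero (P : Admissible μ R a b κ₁ κ₂ β γ T M ε) (ht : t ∈ Icc 0 T) :
    ∃ y, S.q t y = 0 := by
  obtain ⟨y, hy⟩ := exists_isMin (S.sp_rad.cont t) (S.sp_rad.periodic t)
  have hmin : IsLocalMin (S.rad t) y := Eventually.of_forall hy
  have h0 : px S.rad t y = 0 := hmin.deriv_eq_zero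
  rw [px_rad ht y, neg_eq_zero] at h0
  exact ⟨y, (mul_eq_zero.1 h0).resolve_left (mul_pos P.a_pos (S.v_pos t y)).ne'⟩

theorem q_bound (P : Admissible μ R a b κ₁ κ₂ β γ T M ε) :
    ∃ C, 0 < C ∧ ∀ S : Sol μ R a b κ₁ κ₂ β γ T, S.Bounded M ε → ∀ t ∈ Icc 0 T, ∀ x,
      |S.q t x| ≤ C := by
  obtain ⟨C, C_pos, h⟩ := px_q_bound P
  refine ⟨C, C_pos, fun S hS t ht x => ?_⟩
  obtain ⟨y, hy⟩ := exists_q_eq_zero (S := S) P ht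
  obtain ⟨x', hx', ex⟩ := exists_mem_period x (S.sp_q.periodic t)
  obtain ⟨y', hy', ey⟩ := exists_mem_period y (S.sp_q.periodic t)
  have c := S.sp_q.px.cont t
  have h1 := sub_le_tInt (S.sp_q.hasDerivAt_px t) c (continuous_const (y := C))
    (fun z => h S hS t ht z) hx' hy'
  have h2 := sub_le_tInt (S.sp_q.hasDerivAt_px t) c (continuous_const (y := C))
    (fun z => h S hS t ht z) hy' hx'
  rw [tInt_const, ← ex, ← ey, hy] at h1 h2
  exact abs_le.2 ⟨by linarith, by linarith⟩

variable (S) in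
/-- The heat source: the part of `c_v θ_t` not due to heat conduction. -/
def source (t x : ℝ) : ℝ := R / (γ - 1) * pt S.θ t x - px S.flux t x

theorem sp_source (S : Sol μ R a b κ₁ κ₂ β γ T) : SmoothPeriodic S.source :=
  ((SmoothPeriodic.const _).mul S.sp_θ.pt).sub S.sp_flux.px

theorem source_bound (P : Admissible μ R a b κ₁ κ₂ β γ T M ε) :
    ∃ C, 0 < C ∧ ∀ S : Sol μ R a b κ₁ κ₂ β γ T, S.Bounded M ε → ∀ t ∈ Icc 0 T,
      tInt (fun x => S.source t x ^ 2) ≤ C * (1 + S.visc t) := by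
  obtain ⟨c, C, c_pos, C_pos, hv⟩ := v_bounds P
  obtain ⟨Cθ, Cθ_one, hθ⟩ := θ_bound P
  obtain ⟨Cq, Cq_pos, hq⟩ := px_q_bound P
  obtain ⟨Cu, Cu_pos, hu⟩ := px_u_sq_le P
  obtain ⟨CU, CU_pos, hU⟩ := px_u_bound P
  have hμ := P.μ_pos
  have hR := P.R_pos
  have Cθ_pos : 0 < Cθ := zero_lt_one.trans_le Cθ_one
  set K := μ ^ 2 / c ^ 2 * Cu + R ^ 2 * Cθ ^ 2 / c ^ 2 with hK
  have K_pos : 0 < K := by positivity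
  refine ⟨3 * Cq ^ 2 + 3 * K * CU, by positivity, fun S hS t ht => ?_⟩
  have U_nonneg := visc_nonneg S t
  have key := tInt_le_combination (c₁ := 3 * K * (1 + S.visc t)) (c₂ := 0) (c₃ := 0)
    (c₄ := 3 * Cq ^ 2)
    ((S.sp_source.pow 2).cont t) ((S.sp_u.px.pow 2).cont t) ((S.sp_u.pow 2).cont t)
    ((S.sp_u.pow 2).cont t) (fun x => by
      have v_pos := S.v_pos t x
      have θ_pos := S.θ_pos t x
      have hvc := (hv S hS t ht x).1
      have hux := hu S hS t ht x
      have hθx := hθ S hS t ht x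
      have hqx := sq_le_sq' (abs_le.1 (hq S hS t ht x)).1 (abs_le.1 (hq S hS t ht x)).2
      set y₁ := μ * px S.u t x ^ 2 / S.v t x with hy₁
      set y₂ := R * S.θ t x * px S.u t x / S.v t x with hy₂
      have e : S.source t x = -px S.q t x + y₁ - y₂ := by
        rw [source, temperature_eq ht x]; ring
      have i1 : y₁ ^ 2 ≤ μ ^ 2 / c ^ 2 * Cu * (1 + S.visc t) * px S.u t x ^ 2 := by
        have e1 : y₁ ^ 2 = μ ^ 2 / S.v t x ^ 2 * px S.u t x ^ 2 * px S.u t x ^ 2 := by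
          rw [hy₁]; field_simp
        have e2 : μ ^ 2 / c ^ 2 * Cu * (1 + S.visc t) = μ ^ 2 / c ^ 2 * (Cu * (1 + S.visc t)) := by
          ring
        rw [e1, e2]
        gcongr
      have i2 : y₂ ^ 2 ≤ R ^ 2 * Cθ ^ 2 / c ^ 2 * px S.u t x ^ 2 := by
        have e1 : y₂ ^ 2 = R ^ 2 * S.θ t x ^ 2 / S.v t x ^ 2 * px S.u t x ^ 2 := by
          rw [hy₂]; field_simp
        rw [e1]
        gcongr
      have i3 : 0 ≤ R ^ 2 * Cθ ^ 2 / c ^ 2 * S.visc t * px S.u t x ^ 2 := by positivity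
      have i4 : S.source t x ^ 2 ≤ 3 * (px S.q t x ^ 2 + y₁ ^ 2 + y₂ ^ 2) := by
        rw [e]
        nlinarith [sq_nonneg (px S.q t x + y₁), sq_nonneg (px S.q t x - y₂), sq_nonneg (y₁ + y₂)]
      rw [hK]
      linarith)
  have k := mul_le_mul_of_nonneg_left ((hU S hS).1 t ht)
    (by positivity : 0 ≤ 3 * K * (1 + S.visc t))
  have : 0 ≤ 3 * Cq ^ 2 * S.visc t := by positivity
  linarith

variable (S) in
/-- The Lagrangian heat conductivity `κ / v`. -/
def cond (t x : ℝ) : ℝ := κ₁ / S.v t x + κ₂ * S.θ t x ^ β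

theorem sp_cond (S : Sol μ R a b κ₁ κ₂ β γ T) : SmoothPeriodic S.cond :=
  ((SmoothPeriodic.const κ₁).div S.sp_v S.v_pos).add
    ((SmoothPeriodic.const κ₂).mul (S.sp_θ.rpow S.θ_pos β))

theorem flux_eq (S : Sol μ R a b κ₁ κ₂ β γ T) (t x : ℝ) :
    S.flux t x = S.cond t x * px S.θ t x := by
  have := S.v_pos t x
  simp only [flux, kappa, cond]
  field_simp

theorem cond_bounds (P : Admissible μ R a b κ₁ κ₂ β γ T M ε) :
    ∃ c C, 0 < c ∧ 0 < C ∧ ∀ S : Sol μ R a b κ₁ κ₂ β γ T, S.Bounded M ε → ∀ t ∈ Icc 0 T, ∀ x,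
      c ≤ S.cond t x ∧ S.cond t x ≤ C := by
  obtain ⟨c, C, c_pos, C_pos, hv⟩ := v_bounds P
  obtain ⟨Cθ, Cθ_one, hθ⟩ := θ_bound P
  have hκ₁ := P.κ₁_pos
  have hκ₂ := P.κ₂_pos
  have hp := rpow_pos_of_pos (zero_lt_one.trans_le Cθ_one) β
  refine ⟨κ₁ / C, κ₁ / c + κ₂ * Cθ ^ β, by positivity, by positivity, fun S hS t ht x => ?_⟩
  obtain ⟨h1, h2⟩ := hv S hS t ht x
  have v_pos := S.v_pos t x
  have θ_pos := S.θ_pos t x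
  have hr := rpow_pos_of_pos θ_pos β
  have hr' := Real.rpow_le_rpow θ_pos.le (hθ S hS t ht x) (by linarith [P.four_le_β] : 0 ≤ β)
  constructor
  · have : κ₁ / C ≤ κ₁ / S.v t x := by gcongr
    exact this.trans (le_add_of_nonneg_right (by positivity))
  · simp only [cond]
    gcongr

theorem hasDerivAt_conductivity {V Θ : ℝ → ℝ} {V' Θ' s : ℝ} (hV : HasDerivAt V V' s)
    (hΘ : HasDerivAt Θ Θ' s) (hV0 : V s ≠ 0) (hΘ0 : Θ s ≠ 0) :
    HasDerivAt (fun r => κ₁ / V r + κ₂ * Θ r ^ β)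
      (-(κ₁ / V s ^ 2 * V') + κ₂ * (Θ' * β * Θ s ^ (β - 1))) s := by
  have h := ((hasDerivAt_const s κ₁).div hV hV0).add
    ((hΘ.rpow_const (p := β) (Or.inl hΘ0)).const_mul κ₂)
  exact h.congr_deriv (by ring)

theorem tInt_pt_flux_sq (ht : t ∈ Icc 0 T) :
    tInt (pt (fun s y => S.flux s y ^ 2) t)
      = tInt (fun x => -2 * px S.flux t x * S.cond t x * pt S.θ t x
        + 2 * S.flux t x * (κ₁ / S.v t x ^ 2)
          * (px S.v t x * pt S.θ t x - px S.u t x * px S.θ t x)) := by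
  have hg : SmoothPeriodic fun s y => 2 * S.flux s y * (S.cond s y * pt S.θ s y) :=
    ((SmoothPeriodic.const 2).mul S.sp_flux).mul (S.sp_cond.mul S.sp_θ.pt)
  have e : (fun x => -2 * px S.flux t x * S.cond t x * pt S.θ t x
        + 2 * S.flux t x * (κ₁ / S.v t x ^ 2)
          * (px S.v t x * pt S.θ t x - px S.u t x * px S.θ t x))
      = fun x => pt (fun s y => S.flux s y ^ 2) t x
        + -1 * px (fun s y => 2 * S.flux s y * (S.cond s y * pt S.θ s y)) t x := by
    funext x
    have hv := (S.v_pos t x).ne'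
    have hθ := (S.θ_pos t x).ne'
    have ct := pt_eq_of_hasDerivAt (f := S.cond) (hasDerivAt_conductivity (κ₁ := κ₁) (κ₂ := κ₂)
      (β := β) (S.sp_v.hasDerivAt_pt t x) (S.sp_θ.hasDerivAt_pt t x) hv hθ)
    have cx := px_eq_of_hasDerivAt (f := S.cond) (hasDerivAt_conductivity (κ₁ := κ₁) (κ₂ := κ₂)
      (β := β) (S.sp_v.hasDerivAt_px t x) (S.sp_θ.hasDerivAt_px t x) hv hθ)
    have ft : pt S.flux t x = pt S.cond t x * px S.θ t x + S.cond t x * px (pt S.θ) t x := by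
      rw [← S.sp_θ.comm, show S.flux = fun s y => S.cond s y * px S.θ s y from
        funext fun s => funext fun y => S.flux_eq s y]
      exact pt_eq_of_hasDerivAt (f := fun s y => S.cond s y * px S.θ s y)
        ((S.sp_cond.hasDerivAt_pt t x).mul (S.sp_θ.px.hasDerivAt_pt t x))
    rw [pt_eq_of_hasDerivAt (f := fun s y => S.flux s y ^ 2)
      ((S.sp_flux.hasDerivAt_pt t x).fun_pow 2), ft,
      px_eq_of_hasDerivAt (f := fun s y => 2 * S.flux s y * (S.cond s y * pt S.θ s y))
        (((S.sp_flux.hasDerivAt_px t x).const_mul 2).mul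
          ((S.sp_cond.hasDerivAt_px t x).mul (S.sp_θ.pt.hasDerivAt_px t x))),
      ct, cx, ← pt_v ht]
    push_cast
    ring
  rw [e, tInt_add ((S.sp_flux.pow 2).pt.cont t) ((hg.px.cont t).const_mul _),
    tInt_const_mul, hg.tInt_px]
  ring

/-- Pointwise bound on the production of `F ^ 2`, where `F` is the heat flux with derivative `y`. -/
theorem flux_production_le {F y g k w z v cv κ₁ c k₀ k₁ V Cu X : ℝ} (κ₁_pos : 0 < κ₁)
    (cv_pos : 0 < cv) (c_pos : 0 < c) (k₀_pos : 0 < k₀) (Cu_nonneg : 0 ≤ Cu) (hvc : c ≤ v)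
    (hk0 : k₀ ≤ k) (hk1 : k ≤ k₁) (hF : F ^ 2 ≤ X) (V_nonneg : 0 ≤ V)
    (hz : z ^ 2 ≤ Cu * (1 + V)) :
    -2 * y * k * ((y + g) / cv)
        + 2 * F * (κ₁ / v ^ 2) * (w * ((y + g) / cv) - z * (F / k))
      ≤ -(k₀ / cv / 2) * y ^ 2 + (k₁ / cv + 1) * g ^ 2
        + ((1 + 2 / (k₀ / cv)) * (κ₁ / (c ^ 2 * cv)) ^ 2 * X * w ^ 2
          + 2 * κ₁ / (c ^ 2 * k₀) * (1 + Cu) * (1 + V) * F ^ 2) := by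
  have v_pos : 0 < v := c_pos.trans_le hvc
  have k_pos : 0 < k := k₀_pos.trans_le hk0
  set d := k₀ / cv with hd
  have d_pos : 0 < d := by positivity
  set h₁ := κ₁ / (c ^ 2 * cv) with hh₁
  set h := κ₁ / (v ^ 2 * cv) with hh
  have h_pos : 0 < h := by positivity
  have h_le : h ≤ h₁ := by
    rw [hh, hh₁]; gcongr
  have e : -2 * y * k * ((y + g) / cv)
      + 2 * F * (κ₁ / v ^ 2) * (w * ((y + g) / cv) - z * (F / k))
      = k / cv * (-2 * y * (y + g)) + 2 * (h * F * w) * y + 2 * (h * F * w) * g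
        + 2 * κ₁ / (v ^ 2 * k) * F ^ 2 * -z := by
    rw [hh]; field_simp; ring
  have i1 : k / cv * (-2 * y * (y + g)) ≤ k / cv * (-y ^ 2 + g ^ 2) :=
    mul_le_mul_of_nonneg_left (by nlinarith [sq_nonneg (y + g)]) (by positivity)
  have i2 : d * y ^ 2 ≤ k / cv * y ^ 2 := by rw [hd]; gcongr
  have i3 : k / cv * g ^ 2 ≤ k₁ / cv * g ^ 2 := by gcongr
  have i4 : 2 * (h * F * w) * y ≤ d / 2 * y ^ 2 + 2 / d * (h * F * w) ^ 2 := by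
    have e : d / 2 * y ^ 2 + 2 / d * (h * F * w) ^ 2 - 2 * (h * F * w) * y
        = (d * y - 2 * (h * F * w)) ^ 2 / (2 * d) := by
      field_simp; ring
    have : 0 ≤ (d * y - 2 * (h * F * w)) ^ 2 / (2 * d) := by positivity
    linarith
  have i5 : 2 * (h * F * w) * g ≤ g ^ 2 + (h * F * w) ^ 2 := by
    nlinarith [sq_nonneg (h * F * w - g)]
  have i6 : (1 + 2 / d) * (h * F * w) ^ 2 ≤ (1 + 2 / d) * h₁ ^ 2 * X * w ^ 2 := by
    have : h ^ 2 * F ^ 2 * w ^ 2 ≤ h₁ ^ 2 * X * w ^ 2 := by gcongr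
    have := mul_le_mul_of_nonneg_left this (by positivity : 0 ≤ 1 + 2 / d)
    calc _ = (1 + 2 / d) * (h ^ 2 * F ^ 2 * w ^ 2) := by ring
      _ ≤ _ := this
      _ = _ := by ring
  have i7 : 2 * κ₁ / (v ^ 2 * k) * F ^ 2 * -z
      ≤ 2 * κ₁ / (c ^ 2 * k₀) * (1 + Cu) * (1 + V) * F ^ 2 := by
    have hz' : -z ≤ (1 + Cu) * (1 + V) := by
      nlinarith [sq_nonneg (z + 1), mul_nonneg Cu_nonneg V_nonneg]
    have j1 : 2 * κ₁ / (v ^ 2 * k) * F ^ 2 * -z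
        ≤ 2 * κ₁ / (v ^ 2 * k) * F ^ 2 * ((1 + Cu) * (1 + V)) :=
      mul_le_mul_of_nonneg_left hz' (by positivity)
    have j2 : 2 * κ₁ / (v ^ 2 * k) * F ^ 2 * ((1 + Cu) * (1 + V))
        ≤ 2 * κ₁ / (c ^ 2 * k₀) * F ^ 2 * ((1 + Cu) * (1 + V)) := by gcongr
    calc _ ≤ _ := j1.trans j2
      _ = _ := by ring
  rw [e]
  linarith

/-- Energy estimate for the heat flux. -/
theorem flux_bound (P : Admissible μ R a b κ₁ κ₂ β γ T M ε) :
    ∃ C, 0 < C ∧ ∀ S : Sol μ R a b κ₁ κ₂ β γ T, S.Bounded M ε → ∀ t ∈ Icc 0 T,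
      tInt (fun x => S.flux t x ^ 2) ≤ C := by
  obtain ⟨c, C, c_pos, C_pos, hv⟩ := v_bounds P
  obtain ⟨k₀, k₁, k₀_pos, k₁_pos, hk⟩ := cond_bounds P
  obtain ⟨N, N_pos, hN⟩ := px_v_bound P
  obtain ⟨Cu, Cu_pos, hu⟩ := px_u_sq_le P
  obtain ⟨CU, CU_pos, hU⟩ := px_u_bound P
  obtain ⟨Cg, Cg_pos, hg⟩ := source_bound P
  have hκ₁ := P.κ₁_pos
  have hT := P.T_pos
  have hM : 0 < M := zero_lt_one.trans_le P.one_le_M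
  set cv := R / (γ - 1) with hcv
  have cv_pos : 0 < cv := P.cv_pos
  set d := k₀ / cv with hd
  have d_pos : 0 < d := by positivity
  set h₁ := κ₁ / (c ^ 2 * cv) with hh₁
  have h₁_pos : 0 < h₁ := by positivity
  set H := (1 + 2 / d) * h₁ ^ 2 with hH
  have H_pos : 0 < H := by positivity
  set δ := d / (4 * (H * N)) with hδ
  have δ_pos : 0 < δ := by positivity
  set A₁ := 2 * κ₁ / (c ^ 2 * k₀) * (1 + Cu) with hA₁
  have A₁_pos : 0 < A₁ := by positivity
  set A := H * N * (1 + 1 / δ) + A₁ with hA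
  have A_pos : 0 < A := by positivity
  set B := (k₁ / cv + 1) * Cg with hB
  have B_pos : 0 < B := by positivity
  refine ⟨(k₁ ^ 2 * M ^ 2 + B * (T + CU)) * exp (A * (T + CU)), by positivity, fun S hS => ?_⟩
  have cV : Continuous fun t => 1 + S.visc t := continuous_const.add (continuous_visc S)
  have V_nonneg : ∀ t, 0 ≤ 1 + S.visc t := fun t => add_nonneg zero_le_one (visc_nonneg S t)
  have cF := S.sp_flux
  refine (gronwall_dissipation hT.le (E := fun t => tInt (fun x => S.flux t x ^ 2))
    (D := fun t => d / 4 * tInt (fun x => px S.flux t x ^ 2)) (A := fun t => A * (1 + S.visc t))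
    (B := fun t => B * (1 + S.visc t))
    (fun t _ => (cF.pow 2).hasDerivAt_tInt t)
    (continuous_const.mul (cF.px.pow 2).continuous_tInt) (continuous_const.mul cV)
    (continuous_const.mul cV) (fun t => tInt_nonneg fun x => sq_nonneg _)
    (fun t => mul_nonneg (by positivity) (tInt_nonneg fun x => sq_nonneg _))
    (fun t => mul_nonneg A_pos.le (V_nonneg t)) (fun t => mul_nonneg B_pos.le (V_nonneg t))
    (fun t ht => ?_) ?_ (integral_mul_one_add_le (continuous_visc S) A_pos.le (hU S hS).2)
    (integral_mul_one_add_le (continuous_visc S) B_pos.le (hU S hS).2)).1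
  · have U_nonneg := visc_nonneg S t
    have F_nonneg : 0 ≤ tInt (fun x => S.flux t x ^ 2) := tInt_nonneg fun x => sq_nonneg _
    set Y := tInt (fun x => px S.flux t x ^ 2) with hY
    set X := (1 + 1 / δ) * tInt (fun y => S.flux t y ^ 2) + δ * Y with hX
    have X_nonneg : 0 ≤ X := (sq_nonneg _).trans (S.sp_flux.sq_le δ_pos t 0)
    rw [tInt_pt_flux_sq ht]
    have c₁ := cF.cont t
    have c₂ := cF.px.cont t
    have c₃ := S.sp_cond.cont t
    have c₄ := S.sp_θ.pt.cont t
    have c₅ := S.sp_v.px.cont t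
    have c₆ := S.sp_u.px.cont t
    have c₇ := S.sp_θ.px.cont t
    have c₈ : Continuous fun x => κ₁ / S.v t x ^ 2 :=
      continuous_const.div ((S.sp_v.cont t).pow 2) fun x => (pow_pos (S.v_pos t x) 2).ne'
    have e₃ : tInt (fun x => H * X * px S.v t x ^ 2 + A₁ * (1 + S.visc t) * S.flux t x ^ 2)
        = H * X * tInt (fun x => px S.v t x ^ 2)
          + A₁ * (1 + S.visc t) * tInt (fun x => S.flux t x ^ 2) := by
      rw [tInt_add (by fun_prop) (by fun_prop), tInt_const_mul, tInt_const_mul]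
    have key := tInt_le_combination (c₁ := -(d / 2)) (c₂ := k₁ / cv + 1) (c₃ := 1) (c₄ := 0)
      (f := fun x => -2 * px S.flux t x * S.cond t x * pt S.θ t x
        + 2 * S.flux t x * (κ₁ / S.v t x ^ 2)
          * (px S.v t x * pt S.θ t x - px S.u t x * px S.θ t x))
      (k := fun x => H * X * px S.v t x ^ 2 + A₁ * (1 + S.visc t) * S.flux t x ^ 2)
      (by fun_prop) ((cF.px.pow 2).cont t) ((S.sp_source.pow 2).cont t) (by fun_prop) (fun x => by
        have v_pos := S.v_pos t x
        have hvc := (hv S hS t ht x).1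
        obtain ⟨hk0, hk1⟩ := hk S hS t ht x
        have k_pos : 0 < S.cond t x := k₀_pos.trans_le hk0
        have hux := hu S hS t ht x
        have hF : S.flux t x ^ 2 ≤ X := S.sp_flux.sq_le δ_pos t x
        have hθt : pt S.θ t x = (px S.flux t x + S.source t x) / cv := by
          rw [source]; field_simp; ring
        have hθx : px S.θ t x = S.flux t x / S.cond t x := by
          rw [flux_eq]; field_simp
        rw [hθt, hθx]
        have := flux_production_le (y := px S.flux t x) (g := S.source t x) (w := px S.v t x)
          P.κ₁_pos cv_pos c_pos k₀_pos Cu_pos.le hvc hk0 hk1 hF U_nonneg hux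
        rw [← hd, ← hh₁, ← hH, ← hA₁] at this
        simpa only [one_mul, add_zero] using this)
    rw [e₃, ← hY] at key
    have k1 := mul_le_mul_of_nonneg_left (hN S hS t ht) (by positivity : 0 ≤ H * X)
    have k2 := mul_le_mul_of_nonneg_left (hg S hS t ht) (by positivity : 0 ≤ k₁ / cv + 1)
    have e1 : H * X * N
        = H * N * (1 + 1 / δ) * tInt (fun y => S.flux t y ^ 2) + d / 4 * Y := by
      have : H * N * δ = d / 4 := by rw [hδ]; field_simp
      rw [hX, ← this]; ring
    have p : 0 ≤ H * N * (1 + 1 / δ) * S.visc t * tInt (fun y => S.flux t y ^ 2) := by positivity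
    have e2 : A * (1 + S.visc t) * tInt (fun x => S.flux t x ^ 2)
        = H * N * (1 + 1 / δ) * tInt (fun y => S.flux t y ^ 2)
          + H * N * (1 + 1 / δ) * S.visc t * tInt (fun y => S.flux t y ^ 2)
          + A₁ * (1 + S.visc t) * tInt (fun x => S.flux t x ^ 2) := by
      rw [hA]; ring
    rw [e2, hB]
    linarith
  · have zero_mem : (0 : ℝ) ∈ Icc 0 T := ⟨le_rfl, hT.le⟩
    have i : tInt (fun x => S.flux 0 x ^ 2) ≤ k₁ ^ 2 * tInt (fun x => px S.θ 0 x ^ 2) := by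
      rw [← tInt_const_mul]
      refine tInt_mono ((cF.pow 2).cont 0) (((S.sp_θ.px.pow 2).cont 0).const_mul _) fun x => ?_
      obtain ⟨h0, h1⟩ := hk S hS 0 zero_mem x
      have := k₀_pos.trans_le h0
      rw [flux_eq, mul_pow]
      gcongr
    exact i.trans (mul_le_mul_of_nonneg_left (hS.data_le P.one_le_M).2.2.2.2 (by positivity))

theorem px_θ_bound (P : Admissible μ R a b κ₁ κ₂ β γ T M ε) :
    ∃ C, 0 < C ∧ ∀ S : Sol μ R a b κ₁ κ₂ β γ T, S.Bounded M ε → ∀ t ∈ Icc 0 T,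
      tInt (fun x => px S.θ t x ^ 2) ≤ C := by
  obtain ⟨k₀, k₁, k₀_pos, k₁_pos, hk⟩ := cond_bounds P
  obtain ⟨C, C_pos, hF⟩ := flux_bound P
  refine ⟨1 / k₀ ^ 2 * C, by positivity, fun S hS t ht => ?_⟩
  refine le_trans ?_ (mul_le_mul_of_nonneg_left (hF S hS t ht) (by positivity))
  rw [← tInt_const_mul]
  refine tInt_mono ((S.sp_θ.px.pow 2).cont t) (((S.sp_flux.pow 2).cont t).const_mul _) fun x => ?_
  have h0 := (hk S hS t ht x).1
  have : k₀ ^ 2 * px S.θ t x ^ 2 ≤ S.flux t x ^ 2 := by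
    rw [flux_eq, mul_pow]
    gcongr
  rw [one_div_mul_eq_div, le_div_iff₀ (by positivity)]
  linarith

theorem px_px_q_eq (ht : t ∈ Icc 0 T) (x : ℝ) :
    px (px S.q) t x = S.v t x * (4 * b * S.θ t x ^ 3 * px S.θ t x + a * S.v t x * S.q t x)
      + px S.q t x * px S.v t x / S.v t x := by
  have hv := (S.v_pos t x).ne'
  have h := (S.sp_v.hasDerivAt_px t x).mul ((((S.sp_θ.hasDerivAt_px t x).fun_pow 4).const_mul b).sub
    (S.sp_rad.hasDerivAt_px t x))
  have e : px S.q t = fun y => S.v t y * (b * S.θ t y ^ 4 - S.rad t y) :=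
    funext fun y => S.px_q t y
  have h2 : px (px S.q) t x = _ := px_eq_of_hasDerivAt (f := px S.q) (by rw [e]; exact h)
  rw [h2, px_rad ht, px_q S t x]
  simp only [Pi.sub_apply]
  field_simp
  ring

theorem px_px_q_bound (P : Admissible μ R a b κ₁ κ₂ β γ T M ε) :
    ∃ C, 0 < C ∧ ∀ S : Sol μ R a b κ₁ κ₂ β γ T, S.Bounded M ε → ∀ t ∈ Icc 0 T,
      tInt (fun x => px (px S.q) t x ^ 2) ≤ C := by
  obtain ⟨c, C, c_pos, C_pos, hv⟩ := v_bounds P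
  obtain ⟨Cθ, Cθ_one, hθ⟩ := θ_bound P
  obtain ⟨Q₁, Q₁_pos, hq₁⟩ := px_q_bound P
  obtain ⟨Q, Q_pos, hq⟩ := q_bound P
  obtain ⟨N, N_pos, hN⟩ := px_v_bound P
  obtain ⟨K, K_pos, hK⟩ := px_θ_bound P
  have ha := P.a_pos
  have hb := P.b_pos
  have Cθ_pos : 0 < Cθ := zero_lt_one.trans_le Cθ_one
  refine ⟨3 * (C * (4 * b * Cθ ^ 3)) ^ 2 * K + 3 * (Q₁ / c) ^ 2 * N + 3 * (C * (a * C) * Q) ^ 2,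
    by positivity, fun S hS t ht => ?_⟩
  have key := tInt_le_combination (c₁ := 3 * (C * (4 * b * Cθ ^ 3)) ^ 2) (c₂ := 3 * (Q₁ / c) ^ 2)
    (c₃ := 0) (c₄ := 3 * (C * (a * C) * Q) ^ 2)
    ((S.sp_q.px.px.pow 2).cont t) ((S.sp_θ.px.pow 2).cont t) ((S.sp_v.px.pow 2).cont t)
    ((S.sp_u.pow 2).cont t) (fun x => by
      have v_pos := S.v_pos t x
      have θ_pos := S.θ_pos t x
      obtain ⟨h1, h2⟩ := hv S hS t ht x
      have h3 := hθ S hS t ht x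
      have h4 := sq_le_sq' (abs_le.1 (hq S hS t ht x)).1 (abs_le.1 (hq S hS t ht x)).2
      have h5 := sq_le_sq' (abs_le.1 (hq₁ S hS t ht x)).1 (abs_le.1 (hq₁ S hS t ht x)).2
      have i1 : (S.v t x * (4 * b * S.θ t x ^ 3)) ^ 2 * px S.θ t x ^ 2
          ≤ (C * (4 * b * Cθ ^ 3)) ^ 2 * px S.θ t x ^ 2 := by gcongr
      have i2 : (S.v t x * (a * S.v t x)) ^ 2 * S.q t x ^ 2 ≤ (C * (a * C)) ^ 2 * Q ^ 2 := by
        gcongr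
      have i3 : px S.q t x ^ 2 / S.v t x ^ 2 * px S.v t x ^ 2
          ≤ Q₁ ^ 2 / c ^ 2 * px S.v t x ^ 2 := by gcongr
      have e : px (px S.q) t x = S.v t x * (4 * b * S.θ t x ^ 3) * px S.θ t x
          + S.v t x * (a * S.v t x) * S.q t x + px S.q t x / S.v t x * px S.v t x := by
        rw [px_px_q_eq ht]; ring
      set y₁ := S.v t x * (4 * b * S.θ t x ^ 3) * px S.θ t x with hy₁
      set y₂ := S.v t x * (a * S.v t x) * S.q t x with hy₂
      set y₃ := px S.q t x / S.v t x * px S.v t x with hy₃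
      have i4 : (y₁ + y₂ + y₃) ^ 2 ≤ 3 * (y₁ ^ 2 + y₂ ^ 2 + y₃ ^ 2) := by
        nlinarith [sq_nonneg (y₁ - y₂), sq_nonneg (y₁ - y₃), sq_nonneg (y₂ - y₃)]
      rw [← mul_pow] at i1 i2
      rw [← div_pow, ← mul_pow, ← div_pow] at i3
      rw [e]
      linarith)
  have k1 := mul_le_mul_of_nonneg_left (hK S hS t ht)
    (by positivity : 0 ≤ 3 * (C * (4 * b * Cθ ^ 3)) ^ 2)
  have k2 := mul_le_mul_of_nonneg_left (hN S hS t ht) (by positivity : 0 ≤ 3 * (Q₁ / c) ^ 2)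
  linarith

end Sol

end RadHydro

theorem stmt_17 (μ R a b κ₁ κ₂ β γ : ℝ)
    (hμ : 0 < μ) (hR : 0 < R) (ha : 0 < a) (hb : 0 < b)
    (hκ₁ : 0 < κ₁) (hκ₂ : 0 < κ₂) (hβ : 157 / 17 < β) (hγ : 1 < γ)
    (T M ε : ℝ) (hT : 0 < T) (hM : 1 ≤ M) (hε0 : 0 < ε) (hε1 : ε ≤ 1) :
    ∃ C : ℝ, 0 < C ∧
      ∀ S : Sol μ R a b κ₁ κ₂ β γ T, S.Bounded M ε →
        ∀ t ∈ Icc (0 : ℝ) T,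
          L2sq (px (px S.q) t) ≤ C := by
  have P : Admissible μ R a b κ₁ κ₂ β γ T M ε :=
    ⟨hμ, hR, ha, hb, hκ₁, hκ₂, by linarith, hγ, hT, hM, hε0, hε1⟩
  exact Sol.px_px_q_bound P
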